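/- There exist universal constants $\lambda, C > 0$ with the following property. For every $n \in \mathbb{N}$ and $\theta > 0$, setting $N = \tfrac{n(n+1)}{2}$, if $0 < t < \tfrac{\lambda}{\theta N}$ then $\sup_{\varepsilon \in (0,1)} \mathbb{E}_{\mathbf{B}}\big[ e^{\theta (I_n^\varepsilon(t) - n \nu_\varepsilon(t))} \big] \le C$. -/

import Mathlib

open MeasureTheory ProbabilityTheory Real Filter Set

/-- The standard Gaussian-type measure on `ι → ℝ` with covariance `v · Id`:
the product over coordinates of the real Gaussian `N(0, v)`. -/
noncomputable def gaussianPi (ι : Type*) [Fintype ι] (v : NNReal) : Measure (ι → ℝ) :=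
  Measure.pi fun _ => gaussianReal 0 v

/-- A standard Brownian motion with values in `ι → ℝ` (time parameter in `[0,∞)`,
the process being given on all of `ℝ` with the defining properties imposed at
nonnegative times): it starts at the origin, has continuous paths, independent
increments, and Gaussian increments `B_t - B_s ~ N(0, (t-s)·Id)` for `0 ≤ s ≤ t`. -/
structure IsStdBM {Ω : Type*} [MeasurableSpace Ω] (P : Measure Ω)
    {ι : Type*} [Fintype ι] (B : ℝ → Ω → ι → ℝ) : Prop where
  isProb : IsProbabilityMeasure P
  init : ∀ ω, B 0 ω = 0
  cont : ∀ ω i, Continuous fun t => B t ω i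
  meas : ∀ t, Measurable (B t)
  indep_incr : ∀ (n : ℕ) (t : Fin (n + 1) → ℝ), (∀ i, 0 ≤ t i) → Monotone t →
    iIndepFun
      (fun k : Fin n => fun ω => B (t k.succ) ω - B (t k.castSucc) ω) P
  gauss_incr : ∀ s t : ℝ, 0 ≤ s → s ≤ t →
    P.map (fun ω => B t ω - B s ω) = gaussianPi ι (t - s).toNNReal

/-- The `k`-th planar component of a Brownian motion indexed by `κ × Fin 2`;
a standard BM in `(κ × Fin 2) → ℝ` is precisely a family of independent standard
planar Brownian motions indexed by `κ`. -/
def planarComp {Ω κ : Type*} (W : ℝ → Ω → κ × Fin 2 → ℝ) (k : κ) :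
    ℝ → Ω → Fin 2 → ℝ :=
  fun t ω i => W t ω (k, i)

/-- The rescaling `R_ε(x) = ε⁻² R(x/ε)` of a function `R : ℝ² → ℝ`. -/
noncomputable def mollify (R : (Fin 2 → ℝ) → ℝ) (ε : ℝ) (x : Fin 2 → ℝ) : ℝ :=
  (ε ^ 2)⁻¹ * R (ε⁻¹ • x)

/-- `β_ε(A) = ∫_A R_ε(B_s - B_u) du ds` for a single process `B`,
where the integration variable is `p = (u, s) ∈ A ⊆ ℝ₊²`. -/
noncomputable def betaSet (R : (Fin 2 → ℝ) → ℝ) (ε : ℝ) {Ω : Type*}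
    (B : ℝ → Ω → Fin 2 → ℝ) (A : Set (ℝ × ℝ)) (ω : Ω) : ℝ :=
  ∫ p in A, mollify R ε (B p.2 ω - B p.1 ω)

/-- `α_ε(A) = ∫_A R_ε(B¹_s - B²_u) du ds` for two processes `B¹, B²`,
where the integration variable is `p = (u, s) ∈ A ⊆ ℝ₊²`. -/
noncomputable def alphaSet (R : (Fin 2 → ℝ) → ℝ) (ε : ℝ) {Ω : Type*}
    (B₁ B₂ : ℝ → Ω → Fin 2 → ℝ) (A : Set (ℝ × ℝ)) (ω : Ω) : ℝ :=
  ∫ p in A, mollify R ε (B₁ p.2 ω - B₂ p.1 ω)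

/-- The triangle `[0,t]²_< = {(u,s) : 0 ≤ u < s ≤ t}`. -/
def ltSet (t : ℝ) : Set (ℝ × ℝ) := {p : ℝ × ℝ | 0 ≤ p.1 ∧ p.1 < p.2 ∧ p.2 ≤ t}

/-- The planar heat kernel `p_v(x) = (2πv)⁻¹ exp(-|x|²/(2v))`. -/
noncomputable def heatKernel (v : ℝ) (x : Fin 2 → ℝ) : ℝ :=
  (2 * π * v)⁻¹ * Real.exp (-(x 0 ^ 2 + x 1 ^ 2) / (2 * v))

/-- `ν_ε(t) = ∫_0^t ∫_0^s E[R_ε(B_s - B_u)] du ds`, the expectation being written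
via the Gaussian transition density: `E[R_ε(B_s - B_u)] = ∫_{ℝ²} R_ε(x) p_{s-u}(x) dx`. -/
noncomputable def nuReg (R : (Fin 2 → ℝ) → ℝ) (ε t : ℝ) : ℝ :=
  ∫ s in (0:ℝ)..t, ∫ u in (0:ℝ)..s, ∫ x : Fin 2 → ℝ, mollify R ε x * heatKernel (s - u) x

/-- `I_n^ε(t) = ∑_{k=1}^n ∫_0^t∫_0^s R_ε(B^k_s - B^k_u) du ds
+ ∑_{1 ≤ i < j ≤ n} ∫_0^t∫_0^t R_ε(B^i_s - B^j_u) ds du`, for `n` independent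
planar Brownian motions `B¹, …, Bⁿ` (the planar components of a standard BM `W`
in `ℝ^{2n}`). -/
noncomputable def Ifun (R : (Fin 2 → ℝ) → ℝ) (ε : ℝ) {Ω : Type*} {n : ℕ}
    (W : ℝ → Ω → (Fin n × Fin 2) → ℝ) (t : ℝ) (ω : Ω) : ℝ :=
  (∑ k : Fin n, betaSet R ε (planarComp W k) (ltSet t) ω) +
    ∑ p ∈ Finset.univ.filter (fun p : Fin n × Fin n => p.1 < p.2),
      alphaSet R ε (planarComp W p.1) (planarComp W p.2) (Set.Icc 0 t ×ˢ Set.Icc 0 t) ω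


lemma aux_lintegral_peel {α : Type*} [MeasureSpace α] [SigmaFinite (volume : Measure α)] (k : ℕ)
    (F : (Fin (k+1) → α) → ENNReal) (hF : Measurable F) :
    ∫⁻ x, F x = ∫⁻ a : α, ∫⁻ y : Fin k → α, F (Fin.cons a y) := by
  have h := (volume_preserving_piFinSuccAbove (fun _ : Fin (k+1) => α) 0).symm
  rw [← h.lintegral_comp hF]
  rw [Measure.volume_eq_prod, lintegral_prod]
  · simp [MeasurableEquiv.piFinSuccAbove, Fin.insertNthEquiv]
  · exact (hF.comp (MeasurableEquiv.measurable _)).aemeasurable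

lemma aux_measurable_cons {α : Type*} [MeasurableSpace α] (k : ℕ) :
    Measurable (fun p : α × (Fin k → α) => (Fin.cons p.1 p.2 : Fin (k+1) → α)) := by
  refine measurable_pi_lambda _ (fun i => ?_)
  refine Fin.cases ?_ (fun j => ?_) i
  · simpa using measurable_fst
  · simp only [Fin.cons_succ]
    exact (measurable_pi_apply j).comp measurable_snd

lemma aux_lintegral_pow {α : Type*} [MeasureSpace α] [SigmaFinite (volume : Measure α)] (k : ℕ)
    (f : α → ENNReal) (hf : Measurable f) :
    (∫⁻ a, f a) ^ k = ∫⁻ x : Fin k → α, ∏ i, f (x i) := by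
  induction k with
  | zero => simp [volume_pi, Measure.pi_of_empty]
  | succ k ih =>
    rw [aux_lintegral_peel k _ (by fun_prop)]
    simp only [Fin.prod_univ_succ, Fin.cons_zero, Fin.cons_succ]
    have : ∀ a : α, ∫⁻ y : Fin k → α, f a * ∏ i, f (y i) = f a * (∫⁻ a, f a) ^ k := by
      intro a
      rw [lintegral_const_mul _ (by fun_prop), ih]
    simp only [this]
    rw [lintegral_mul_const _ hf, pow_succ, mul_comm]

lemma aux_gaussianPi (v : NNReal) (hv : v ≠ 0) : gaussianPi (Fin 2) v =
    volume.withDensity (fun x => ENNReal.ofReal (heatKernel v x)) := by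
  have hm : Measurable (fun x : Fin 2 → ℝ => ENNReal.ofReal (heatKernel v x)) := by
    unfold heatKernel; fun_prop
  have h1 := (measurePreserving_finTwoArrow (gaussianReal 0 v)).symm
  have h2 := (volume_preserving_finTwoArrow ℝ).symm
  unfold gaussianPi
  rw [← h1.map_eq]
  ext s hs
  rw [withDensity_apply _ hs, MeasurableEquiv.map_apply, ← h2.setLIntegral_comp_preimage hs hm]
  rw [gaussianReal_of_var_ne_zero _ hv, prod_withDensity (by fun_prop) (by fun_prop),
    withDensity_apply _ ((MeasurableEquiv.measurable _) hs), Measure.volume_eq_prod]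
  refine lintegral_congr (fun p => ?_)
  simp only [gaussianPDF, gaussianPDFReal, heatKernel, MeasurableEquiv.finTwoArrow_symm_apply]
  rw [← ENNReal.ofReal_mul (by positivity)]
  congr 1
  have hv' : (0:ℝ) < v := by positivity
  have : √(2 * π * v) * √(2 * π * v) = 2 * π * v := Real.mul_self_sqrt (by positivity)
  rw [mul_mul_mul_comm, ← Real.exp_add, ← mul_inv, this]
  congr 2
  simp
  field_simp
  ring

lemma aux_gauss_lintegral (v : NNReal) (hv : v ≠ 0) (f : (Fin 2 → ℝ) → ENNReal) (hf : Measurable f) :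
    ∫⁻ x, f x ∂(gaussianPi (Fin 2) v) = ∫⁻ x, f x * ENNReal.ofReal (heatKernel v x) := by
  rw [aux_gaussianPi v hv, lintegral_withDensity_eq_lintegral_mul _ _ hf]
  · simp [mul_comm]
  · unfold heatKernel; fun_prop

instance aux_gaussianPi_prob (v : NNReal) : IsProbabilityMeasure (gaussianPi (Fin 2) v) := by
  unfold gaussianPi; infer_instance

lemma aux_gauss_bound (v : NNReal) (r : (Fin 2 → ℝ) → ENNReal) (hr : Measurable r)
    (hr1 : ∫⁻ x, r x ≤ 1) (x : Fin 2 → ℝ) :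
    ∫⁻ z, r (x + z) ∂(gaussianPi (Fin 2) v) ≤ (ENNReal.ofReal (2 * π * v))⁻¹ := by
  by_cases hv : v = 0
  · subst hv; simp
  rw [aux_gauss_lintegral v hv _ (by fun_prop)]
  have hv' : (0:ℝ) < v := by positivity
  have hb : ∀ z, ENNReal.ofReal (heatKernel v z) ≤ (ENNReal.ofReal (2 * π * v))⁻¹ := by
    intro z
    rw [← ENNReal.ofReal_inv_of_pos (by positivity)]
    apply ENNReal.ofReal_le_ofReal
    unfold heatKernel
    have : Real.exp (-(z 0 ^ 2 + z 1 ^ 2) / (2 * v)) ≤ 1 := by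
      apply Real.exp_le_one_iff.2
      rw [neg_div]
      have : 0 ≤ (z 0 ^ 2 + z 1 ^ 2) / (2 * v) := by positivity
      linarith
    exact mul_le_of_le_one_right (by positivity) this
  calc _ ≤ ∫⁻ z, r (x + z) * (ENNReal.ofReal (2 * π * v))⁻¹ := by
        gcongr; exact hb _
    _ = (∫⁻ z, r (x + z)) * (ENNReal.ofReal (2 * π * v))⁻¹ := by
        rw [lintegral_mul_const _ (by fun_prop)]
    _ ≤ _ := by
        rw [lintegral_add_left_eq_self]
        exact mul_le_of_le_one_left' hr1


noncomputable def auxChain (f : ℝ → ENNReal) : (k : ℕ) → ℝ → (Fin k → ℝ) → ENNReal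
  | 0, _, _ => 1
  | (k+1), a, s => f (s 0 - a) * auxChain f k (s 0) (Fin.tail s)

noncomputable def auxD (r : ℝ) : ENNReal := (ENNReal.ofReal (2 * π * r))⁻¹

noncomputable def auxQ (r : ℝ) : ENNReal := if 0 ≤ r then auxD r ^ (1/2 : ℝ) else 0

lemma auxQ_meas : Measurable auxQ := by
  unfold auxQ auxD
  exact Measurable.ite measurableSet_Ici (by fun_prop) measurable_const

lemma auxChain_meas (f : ℝ → ENNReal) (hf : Measurable f) (k : ℕ) :
    Measurable (fun p : ℝ × (Fin k → ℝ) => auxChain f k p.1 p.2) := by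
  induction k with
  | zero => simp only [auxChain]; exact measurable_const
  | succ k ih =>
    simp only [auxChain]
    refine Measurable.mul (by fun_prop) ?_
    have : Measurable (fun p : ℝ × (Fin (k+1) → ℝ) => (p.2 0, (Fin.tail p.2 : Fin k → ℝ))) := by
      unfold Fin.tail; fun_prop
    exact ih.comp this

lemma auxChain_meas' (f : ℝ → ENNReal) (hf : Measurable f) (k : ℕ) (a : ℝ) :
    Measurable (fun s : (Fin k → ℝ) => auxChain f k a s) :=
  (auxChain_meas f hf k).comp (by fun_prop : Measurable (fun s : Fin k → ℝ => (a, s)))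

lemma auxChain_integral (f : ℝ → ENNReal) (hf : Measurable f) (k : ℕ) (a : ℝ) :
    ∫⁻ s, auxChain f k a s = (∫⁻ r, f r) ^ k := by
  induction k generalizing a with
  | zero => simp [auxChain, volume_pi]
  | succ k ih =>
    rw [aux_lintegral_peel k _ (auxChain_meas' f hf _ a)]
    simp only [auxChain, Fin.cons_zero, Fin.tail_cons]
    have : ∀ b : ℝ, ∫⁻ y : Fin k → ℝ, f (b - a) * auxChain f k b y
        = f (b - a) * (∫⁻ r, f r) ^ k := by
      intro b
      rw [lintegral_const_mul _ (auxChain_meas' f hf k b), ih]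
    simp only [this]
    rw [lintegral_mul_const _ (by fun_prop), lintegral_sub_right_eq_self f a, pow_succ, mul_comm]

lemma auxChain_tilt (L T : ℝ) (hL : 0 ≤ L) (k : ℕ) (a : ℝ) (ha : a ≤ T) (s : Fin k → ℝ)
    (hs : ∀ i, s i ≤ T) :
    auxChain auxQ k a s ≤ ENNReal.ofReal (Real.exp (L * (T - a))) *
      auxChain (fun r => auxQ r * ENNReal.ofReal (Real.exp (-(L * r)))) k a s := by
  induction k generalizing a with
  | zero =>
    simp only [auxChain, mul_one]
    rw [ENNReal.one_le_ofReal]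
    exact Real.one_le_exp (mul_nonneg hL (by linarith))
  | succ k ih =>
    simp only [auxChain]
    have h := ih (s 0) (hs 0) (Fin.tail s) (fun i => hs _)
    have he : ENNReal.ofReal (Real.exp (L * (T - s 0))) =
        ENNReal.ofReal (Real.exp (L * (T - a))) * ENNReal.ofReal (Real.exp (-(L * (s 0 - a)))) := by
      rw [← ENNReal.ofReal_mul (by positivity), ← Real.exp_add]
      congr 2; ring
    refine (mul_le_mul_right h (auxQ (s 0 - a))).trans (le_of_eq ?_)
    rw [he]; ring

lemma auxQ_integral (L : ℝ) (hL : 0 < L) :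
    ∫⁻ r, auxQ r * ENNReal.ofReal (Real.exp (-(L * r))) ≤ ENNReal.ofReal ((1 / (2 * L)) ^ (1/2 : ℝ)) := by
  have hI := Real.integral_rpow_mul_exp_neg_mul_Ioi (a := 1/2) (r := L) (by norm_num) hL
  have hpos : 0 < (1 / L) ^ (1/2 : ℝ) * Real.Gamma (1/2) := by
    rw [Real.Gamma_one_half_eq]; positivity
  have hint : IntegrableOn (fun t : ℝ => t ^ ((1/2 : ℝ) - 1) * Real.exp (-(L * t))) (Ioi 0) := by
    by_contra h
    rw [integral_undef h] at hI
    linarith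
  have hint2 := hint.const_mul ((2 * π) ^ (-(1/2) : ℝ))
  have hval : ∫ t in Ioi (0:ℝ), (2 * π) ^ (-(1/2) : ℝ) * (t ^ ((1/2 : ℝ) - 1) * Real.exp (-(L * t)))
      = (1 / (2 * L)) ^ (1/2 : ℝ) := by
    rw [integral_const_mul, hI, Real.Gamma_one_half_eq, Real.sqrt_eq_rpow,
      Real.rpow_neg (by positivity), ← Real.inv_rpow (by positivity),
      ← Real.mul_rpow (by positivity) (by positivity), ← Real.mul_rpow (by positivity) (by positivity)]
    congr 1
    field_simp
  rw [← hval, ofReal_integral_eq_lintegral_ofReal hint2, ← lintegral_indicator measurableSet_Ioi]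
  · apply lintegral_mono_ae
    have : ∀ᵐ r : ℝ, r ≠ 0 := by
      simp [ae_iff]
    filter_upwards [this] with r hr
    rcases lt_or_gt_of_ne hr with h | h
    · simp [auxQ, not_le.2 h]
    · rw [indicator_of_mem (by exact h)]
      have h0 : auxQ r = ENNReal.ofReal ((2 * π) ^ (-(1/2) : ℝ) * r ^ ((1/2 : ℝ) - 1)) := by
        rw [auxQ, if_pos h.le, auxD, ← ENNReal.ofReal_inv_of_pos (by positivity),
          ENNReal.ofReal_rpow_of_nonneg (by positivity) (by norm_num)]
        congr 1
        rw [Real.inv_rpow (by positivity), ← Real.rpow_neg (by positivity),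
          Real.mul_rpow (by positivity) h.le]
        norm_num
      rw [h0, ← ENNReal.ofReal_mul (by positivity)]
      apply le_of_eq; congr 1; ring
  · filter_upwards [self_mem_ae_restrict measurableSet_Ioi] with t ht
    have : (0:ℝ) < t := ht
    simp only [Pi.zero_apply]
    positivity

noncomputable def auxGs (T : ℝ) (k : ℕ) (s : Fin k → ℝ) : ENNReal :=
  Set.indicator {s : Fin k → ℝ | ∀ i, s i ≤ T} (auxChain auxQ k 0) s

noncomputable def auxG (T : ℝ) (k : ℕ) (s : Fin k → ℝ) : ENNReal :=
  ∑ σ : Equiv.Perm (Fin k), auxGs T k (s ∘ σ)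

lemma auxGs_meas (T : ℝ) (k : ℕ) : Measurable (auxGs T k) := by
  unfold auxGs
  refine Measurable.indicator (auxChain_meas' _ auxQ_meas _ _) ?_
  have : {s : Fin k → ℝ | ∀ i, s i ≤ T} = ⋂ i, {s | s i ≤ T} := by ext; simp
  rw [this]
  exact MeasurableSet.iInter (fun i => measurableSet_le (by fun_prop) measurable_const)

lemma auxG_meas (T : ℝ) (k : ℕ) : Measurable (auxG T k) := by
  unfold auxG
  refine Finset.measurable_sum _ (fun σ _ => (auxGs_meas T k).comp ?_)
  exact measurable_pi_lambda _ (fun i => measurable_pi_apply _)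

lemma auxG_integral (T : ℝ) (k : ℕ) : ∫⁻ s, auxG T k s = (k.factorial : ENNReal) * ∫⁻ s, auxGs T k s := by
  unfold auxG
  rw [lintegral_finsetSum]
  · have : ∀ σ : Equiv.Perm (Fin k), ∫⁻ s : Fin k → ℝ, auxGs T k (s ∘ σ) = ∫⁻ s, auxGs T k s := by
      intro σ
      have h := (volume_measurePreserving_piCongrLeft (fun _ : Fin k => ℝ) σ).symm
      rw [← h.lintegral_comp (auxGs_meas T k)]
      rfl
    simp [this, Fintype.card_perm]
  · intro σ _
    exact (auxGs_meas T k).comp (measurable_pi_lambda _ (fun i => measurable_pi_apply _))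

lemma auxGs_integral (T : ℝ) (hT : 0 < T) (k : ℕ) (L : ℝ) (hL : 0 < L) :
    ∫⁻ s, auxGs T k s ≤ ENNReal.ofReal (Real.exp (L * T) * ((1 / (2 * L)) ^ (1/2 : ℝ)) ^ k) := by
  have hm : Measurable (fun r => auxQ r * ENNReal.ofReal (Real.exp (-(L * r)))) :=
    auxQ_meas.mul (by fun_prop)
  calc _ ≤ ∫⁻ s, ENNReal.ofReal (Real.exp (L * T)) *
      auxChain (fun r => auxQ r * ENNReal.ofReal (Real.exp (-(L * r)))) k 0 s := by
        apply lintegral_mono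
        intro s
        unfold auxGs
        apply Set.indicator_le
        intro s hs
        simpa using auxChain_tilt L T hL.le k 0 hT.le s hs
    _ = ENNReal.ofReal (Real.exp (L * T)) * (∫⁻ r, auxQ r * ENNReal.ofReal (Real.exp (-(L * r)))) ^ k := by
        rw [lintegral_const_mul _ (auxChain_meas' _ hm _ _), auxChain_integral _ hm]
    _ ≤ ENNReal.ofReal (Real.exp (L * T)) * (ENNReal.ofReal ((1 / (2 * L)) ^ (1/2 : ℝ))) ^ k := by
        gcongr; exact auxQ_integral L hL
    _ = _ := by
        rw [← ENNReal.ofReal_pow (by positivity), ← ENNReal.ofReal_mul (by positivity)]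

lemma auxG_final (T : ℝ) (hT : 0 < T) (k : ℕ) :
    (∫⁻ s, auxG T k s) ^ 2 ≤ ENNReal.ofReal (k.factorial * (Real.exp 2 / 2 * T) ^ k) := by
  rcases Nat.eq_zero_or_pos k with rfl | hk
  · rw [auxG_integral]; simp [auxGs, auxChain, volume_pi]
  have hk' : (0:ℝ) < k := by exact_mod_cast hk
  have h := auxGs_integral T hT k (k / T) (by positivity)
  rw [auxG_integral]
  have hf : (k.factorial : ENNReal) = ENNReal.ofReal (k.factorial : ℝ) := by simp
  calc _ ≤ ((k.factorial : ENNReal) * ENNReal.ofReal (Real.exp (k / T * T) * ((1 / (2 * (k/T))) ^ (1/2 : ℝ)) ^ k)) ^ 2 := by gcongr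
    _ = ENNReal.ofReal ((k.factorial * (Real.exp (k / T * T) * ((1 / (2 * (k/T))) ^ (1/2 : ℝ)) ^ k)) ^ 2) := by
      rw [hf, ← ENNReal.ofReal_mul (by positivity), ← ENNReal.ofReal_pow (by positivity)]
    _ ≤ _ := by
      apply ENNReal.ofReal_le_ofReal
      have e1 : ((1 / (2 * (k/T))) ^ (1/2 : ℝ)) ^ 2 = T / (2 * k) := by
        rw [← Real.sqrt_eq_rpow, Real.sq_sqrt (by positivity)]; field_simp
      have e2 : Real.exp (k / T * T) ^ 2 = Real.exp 2 ^ k := by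
        rw [← Real.exp_nat_mul, ← Real.exp_nat_mul]; congr 1; field_simp; push_cast; ring
      have e3 : (k.factorial : ℝ) ≤ (k:ℝ) ^ k := by exact_mod_cast Nat.factorial_le_pow k
      have : (k.factorial * (Real.exp (k / T * T) * ((1 / (2 * (k/T))) ^ (1/2 : ℝ)) ^ k)) ^ 2
          = k.factorial * (k.factorial / (k:ℝ)^k) * (Real.exp 2 / 2 * T) ^ k := by
        calc _ = (k.factorial:ℝ) ^ 2 * (Real.exp (k / T * T) ^ 2 * (((1 / (2 * (k/T))) ^ (1/2 : ℝ)) ^ 2) ^ k) := by ring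
          _ = _ := by
            rw [e1, e2, div_pow, mul_pow, mul_pow, div_pow]; field_simp
      rw [this]
      gcongr
      apply mul_le_of_le_one_right (by positivity)
      rw [div_le_one (by positivity)]; exact e3


section
variable {Ω : Type*} [MeasurableSpace Ω]

structure AuxGB (P : Measure Ω) (T : ℝ) (X : ℝ → Ω → Fin 2 → ℝ) : Prop where
  prob : IsProbabilityMeasure P
  meas : ∀ s, Measurable (X s)
  cont : ∀ ω, Continuous (fun s => X s ω)
  gp : IsGaussianProcess (fun (q : ℝ × Fin 2) ω => X q.1 ω q.2) P
  mean : ∀ s i, ∫ ω, X s ω i ∂P = 0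
  cov : ∀ s t, s ∈ Icc 0 T → t ∈ Icc 0 T → ∀ i j,
    cov[fun ω => X s ω i, fun ω => X t ω j; P] = if i = j then min s t else 0

/-- the path of `X` on `[0,a]` -/
def auxPath {Ω : Type*} (X : ℝ → Ω → Fin 2 → ℝ) (a : ℝ) (ω : Ω) (q : Icc (0:ℝ) a × Fin 2) : ℝ :=
  X q.1 ω q.2

@[reducible]
def auxF {Ω : Type*} (X : ℝ → Ω → Fin 2 → ℝ) (a : ℝ) : MeasurableSpace Ω :=
  MeasurableSpace.comap (auxPath X a) inferInstance

lemma auxF_eval {Ω : Type*} (X : ℝ → Ω → Fin 2 → ℝ) (a : ℝ) (r : ℝ) (hr : r ∈ Icc 0 a) :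
    Measurable[auxF X a] (X r) := by
  refine @measurable_pi_lambda _ _ _ (auxF X a) _ _ (fun i => ?_)
  have h : Measurable[auxF X a] (auxPath X a) := comap_measurable _
  exact (measurable_pi_apply ((⟨r, hr⟩, i) : Icc (0:ℝ) a × Fin 2)).comp h

lemma auxPath_meas {X : ℝ → Ω → Fin 2 → ℝ} (hX : ∀ s, Measurable (X s)) (a : ℝ) :
    Measurable (auxPath X a) := by
  refine measurable_pi_lambda _ (fun q => ?_)
  exact (measurable_pi_apply q.2).comp (hX q.1)

lemma auxF_le {X : ℝ → Ω → Fin 2 → ℝ} (hX : ∀ s, Measurable (X s)) (a : ℝ) :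
    auxF X a ≤ ‹MeasurableSpace Ω› := (auxPath_meas hX a).comap_le

lemma auxF_mono {Ω : Type*} (X : ℝ → Ω → Fin 2 → ℝ) {a b : ℝ} (hab : a ≤ b) :
    auxF X a ≤ auxF X b := by
  rw [auxF]
  refine Measurable.comap_le ?_
  refine @measurable_pi_lambda _ _ _ (auxF X b) _ _ (fun q => ?_)
  exact (measurable_pi_apply q.2).comp (auxF_eval X b q.1 ⟨q.1.2.1, q.1.2.2.trans hab⟩)

lemma aux_cov_expand {P : Measure Ω} [IsProbabilityMeasure P] {A B C D : Ω → ℝ} (hA : MemLp A 2 P) (hB : MemLp B 2 P)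
    (hC : MemLp C 2 P) (hD : MemLp D 2 P) (c d : ℝ) :
    cov[fun ω => A ω - c * B ω, fun ω => C ω - d * D ω; P] =
     cov[A, C; P] - d * cov[A, D; P] - c * cov[B, C; P] + c * d * cov[B, D; P] := by
  rw [covariance_fun_sub_fun_sub hA (hB.const_mul c) hC (hD.const_mul d)]
  rw [covariance_const_mul_right, covariance_const_mul_left, covariance_const_mul_left,
    covariance_const_mul_right]
  ring

lemma aux_gauss_comb {P : Measure Ω} {τ S : Type*} {Z : τ → Ω → ℝ} (hZ : IsGaussianProcess Z P)
    (f g : S → τ) (c : S → ℝ) :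
    IsGaussianProcess (fun s ω => Z (f s) ω - c s * Z (g s) ω) P := by
  classical
  refine hZ.of_isGaussianProcess (fun s => ⟨{f s, g s},
    { toFun x := x ⟨f s, by simp⟩ - c s * x ⟨g s, by simp⟩
      map_add' x y := by simp; ring
      map_smul' m x := by simp; ring }, ?_⟩)
  intro ω
  simp

lemma aux_indep_comb {P : Measure Ω} {τ S S' : Type*} {Z : τ → Ω → ℝ} (hZ : IsGaussianProcess Z P)
    (f g : S → τ) (c : S → ℝ) (f' g' : S' → τ) (c' : S' → ℝ)
    (h : ∀ s s', cov[Z (f s), Z (f' s'); P] - c' s' * cov[Z (f s), Z (g' s'); P]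
      - c s * cov[Z (g s), Z (f' s'); P] + c s * c' s' * cov[Z (g s), Z (g' s'); P] = 0) :
    IndepFun (fun ω s => Z (f s) ω - c s * Z (g s) ω) (fun ω s => Z (f' s) ω - c' s * Z (g' s) ω) P := by
  have := hZ.isProbabilityMeasure
  have hL : ∀ t, MemLp (Z t) 2 P := fun t => (hZ.hasGaussianLaw_eval t).memLp_two
  have hm : ∀ t, AEMeasurable (Z t) P := fun t => hZ.aemeasurable t
  apply IsGaussianProcess.indepFun_of_covariance_eq_zero
    (X := fun s ω => Z (f s) ω - c s * Z (g s) ω) (Y := fun s ω => Z (f' s) ω - c' s * Z (g' s) ω)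
  · convert aux_gauss_comb hZ (Sum.elim f f') (Sum.elim g g') (Sum.elim c c') using 1
    ext s ω
    cases s <;> rfl
  · intro s; exact (hm _).sub ((hm _).const_mul _)
  · intro s; exact (hm _).sub ((hm _).const_mul _)
  · intro s s'
    rw [aux_cov_expand (hL _) (hL _) (hL _) (hL _)]
    exact h s s'

lemma AuxGB.law {P : Measure Ω} {T : ℝ} {X : ℝ → Ω → Fin 2 → ℝ} (h : AuxGB P T X) (a b : ℝ)
    (ha : 0 ≤ a) (hab : a ≤ b) (hb : b ≤ T) :
    P.map (fun ω => X b ω - X a ω) = gaussianPi (Fin 2) (b - a).toNNReal := by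
  have := h.prob
  have hL : ∀ t i, MemLp (fun ω => X t ω i) 2 P := fun t i => (h.gp.hasGaussianLaw_eval (t,i)).memLp_two
  have hcov : ∀ i j, cov[fun ω => X b ω i - X a ω i, fun ω => X b ω j - X a ω j; P] =
      if i = j then b - a else 0 := by
    intro i j
    have := aux_cov_expand (hL b i) (hL a i) (hL b j) (hL a j) 1 1
    simp only [one_mul] at this
    rw [this, h.cov b b (by constructor <;> linarith) (by constructor <;> linarith),
      h.cov b a (by constructor <;> linarith) (by constructor <;> linarith),
      h.cov a b (by constructor <;> linarith) (by constructor <;> linarith),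
      h.cov a a (by constructor <;> linarith) (by constructor <;> linarith)]
    split_ifs <;> simp [hab]
  have hgp : IsGaussianProcess (fun (i : Fin 2) ω => X b ω i - X a ω i) P := by
    simpa using aux_gauss_comb h.gp (fun i : Fin 2 => (b, i)) (fun i => (a, i)) (fun _ => 1)
  have hgp2 : IsGaussianProcess (fun (p : (_ : Fin 2) × Unit) ω => X b ω p.1 - X a ω p.1) P :=
    hgp.comp_right (fun p : (_ : Fin 2) × Unit => p.1)
  have hind := IsGaussianProcess.iIndepFun_of_covariance_eq_zero
    (X := fun (i : Fin 2) (_ : Unit) ω => X b ω i - X a ω i) hgp2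
    (fun i _ => hgp.aemeasurable i) (fun i j hij _ _ => by rw [hcov, if_neg hij])
  have hind2 : iIndepFun (fun (i : Fin 2) ω => X b ω i - X a ω i) P :=
    hind.comp (fun _ x => x ()) (fun _ => measurable_pi_apply _)
  rw [iIndepFun_iff_map_fun_eq_pi_map (fun i => hgp.aemeasurable i)] at hind2
  unfold gaussianPi
  refine hind2.trans ?_
  congr 1
  ext1 i
  rw [(hgp.hasGaussianLaw_eval i).map_eq_gaussianReal, ← covariance_self (hgp.aemeasurable i), hcov]
  congr 1
  · rw [integral_sub ((hL b i).integrable (by norm_num)) ((hL a i).integrable (by norm_num)), h.mean, h.mean]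
    simp
  · simp

lemma AuxGB.indep_incr {P : Measure Ω} {T : ℝ} {X : ℝ → Ω → Fin 2 → ℝ} (h : AuxGB P T X) (a b : ℝ)
    (ha : 0 ≤ a) (hab : a ≤ b) (hb : b ≤ T) :
    IndepFun (auxPath X a) (fun ω => X b ω - X a ω) P := by
  have := aux_indep_comb h.gp (fun q : Icc (0:ℝ) a × Fin 2 => ((q.1 : ℝ), q.2)) (fun q => (0, 0)) (fun _ => 0)
    (fun i : Fin 2 => (b, i)) (fun i => (a, i)) (fun _ => 1) ?_
  · simp only [zero_mul, sub_zero, one_mul] at this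
    exact this
  · intro s i
    have h1 := s.1.2.1
    have h2 := s.1.2.2
    dsimp only
    rw [h.cov _ _ (by constructor <;> linarith) (by constructor <;> linarith),
      h.cov _ _ (by constructor <;> linarith) (by constructor <;> linarith)]
    split_ifs <;> simp [h2, h2.trans hab]

lemma AuxGB.step {P : Measure Ω} {T : ℝ} {X : ℝ → Ω → Fin 2 → ℝ} (h : AuxGB P T X) (a b : ℝ)
    (ha : 0 ≤ a) (hab : a ≤ b) (hb : b ≤ T) (r : (Fin 2 → ℝ) → ENNReal) (hr : Measurable r)
    (hr1 : ∫⁻ x, r x ≤ 1) (y : Fin 2 → ℝ) (F : Ω → ENNReal) (hF : Measurable[auxF X a] F) :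
    ∫⁻ ω, F ω * r (X b ω - y) ∂P ≤ (∫⁻ ω, F ω ∂P) * auxD (b - a) := by
  have := h.prob
  have hF' : Measurable F := hF.mono (auxF_le h.meas a) le_rfl
  have hXa : Measurable[auxF X a] (X a) := auxF_eval X a a ⟨ha, le_rfl⟩
  have hU0 : Measurable[auxF X a] (fun ω => (F ω, X a ω - y)) := by
    refine Measurable.prodMk hF ?_
    exact (measurable_id.sub_const y).comp hXa
  have hU : Measurable (fun ω => (F ω, X a ω - y)) := hU0.mono (auxF_le h.meas a) le_rfl
  have hZ : Measurable (fun ω => X b ω - X a ω) := (h.meas b).sub (h.meas a)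
  have hind : IndepFun (fun ω => (F ω, X a ω - y)) (fun ω => X b ω - X a ω) P := by
    have h0 := h.indep_incr a b ha hab hb
    rw [IndepFun_iff_Indep] at h0 ⊢
    exact indep_of_indep_of_le_left h0 hU0.comap_le
  rw [indepFun_iff_map_prod_eq_prod_map_map hU.aemeasurable hZ.aemeasurable, h.law a b ha hab hb] at hind
  have hG : Measurable (fun p : (ENNReal × (Fin 2 → ℝ)) × (Fin 2 → ℝ) => p.1.1 * r (p.1.2 + p.2)) := by
    fun_prop
  calc ∫⁻ ω, F ω * r (X b ω - y) ∂P
      = ∫⁻ ω, (fun p : (ENNReal × (Fin 2 → ℝ)) × (Fin 2 → ℝ) => p.1.1 * r (p.1.2 + p.2))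
        ((F ω, X a ω - y), X b ω - X a ω) ∂P := by
        refine lintegral_congr (fun ω => ?_)
        dsimp only
        congr 2; abel
    _ = ∫⁻ u, ∫⁻ z, u.1 * r (u.2 + z) ∂(gaussianPi (Fin 2) (b-a).toNNReal)
          ∂(P.map (fun ω => (F ω, X a ω - y))) := by
        rw [← lintegral_map hG (hU.prodMk hZ), hind, lintegral_prod _ hG.aemeasurable]
    _ ≤ ∫⁻ u, u.1 * auxD (b - a) ∂(P.map (fun ω => (F ω, X a ω - y))) := by
        refine lintegral_mono (fun u => ?_)
        dsimp only
        rw [lintegral_const_mul _ (by fun_prop)]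
        gcongr
        have := aux_gauss_bound (b-a).toNNReal r hr hr1 u.2
        rwa [Real.coe_toNNReal _ (by linarith)] at this
    _ = _ := by
        rw [lintegral_map (by fun_prop) hU, lintegral_mul_const _ hF']

lemma AuxGB.chain {P : Measure Ω} {T : ℝ} {X : ℝ → Ω → Fin 2 → ℝ} (h : AuxGB P T X)
    (r : (Fin 2 → ℝ) → ENNReal) (hr : Measurable r) (hr1 : ∫⁻ x, r x ≤ 1) (k : ℕ) (a : ℝ)
    (ha : 0 ≤ a) (s : Fin k → ℝ) (hs : Monotone s) (has : ∀ i, a ≤ s i) (hsT : ∀ i, s i ≤ T)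
    (y : Fin k → Fin 2 → ℝ) (F : Ω → ENNReal) (hF : Measurable[auxF X a] F) :
    ∫⁻ ω, F ω * ∏ i, r (X (s i) ω - y i) ∂P ≤ (∫⁻ ω, F ω ∂P) * auxChain auxD k a s := by
  induction k generalizing a F with
  | zero => simp [auxChain]
  | succ k ih =>
    simp only [Fin.prod_univ_succ, auxChain, ← mul_assoc]
    have hF' : Measurable[auxF X (s 0)] (fun ω => F ω * r (X (s 0) ω - y 0)) := by
      refine Measurable.mul (hF.mono (auxF_mono X (has 0)) le_rfl) ?_
      exact (hr.comp (measurable_id.sub_const (y 0))).comp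
        (auxF_eval X (s 0) (s 0) ⟨ha.trans (has 0), le_rfl⟩)
    refine (ih (s 0) (ha.trans (has 0)) (Fin.tail s) (fun i j hij => hs (by simpa using hij))
      (fun i => hs (Fin.zero_le _)) (fun i => hsT _) (Fin.tail y) _ hF').trans ?_
    gcongr
    exact h.step a (s 0) ha (has 0) (hsT 0) r hr hr1 _ F hF

lemma auxChain_sqrt (k : ℕ) (a : ℝ) (s : Fin k → ℝ) (hs : Monotone s) (has : ∀ i, a ≤ s i) :
    auxChain auxD k a s ^ (1/2 : ℝ) = auxChain auxQ k a s := by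
  induction k generalizing a with
  | zero => simp [auxChain]
  | succ k ih =>
    simp only [auxChain]
    rw [ENNReal.mul_rpow_of_nonneg _ _ (by norm_num), ih (s 0) (Fin.tail s)
      (fun i j hij => hs (by simpa using hij)) (fun i => hs (Fin.zero_le _)), auxQ, if_pos]
    linarith [has 0]

lemma AuxGB.half {P : Measure Ω} {T : ℝ} {X : ℝ → Ω → Fin 2 → ℝ} (h : AuxGB P T X)
    (r : (Fin 2 → ℝ) → ENNReal) (hr : Measurable r) (hr1 : ∫⁻ x, r x ≤ 1) (k : ℕ)
    (s : Fin k → ℝ) (hs : ∀ i, s i ∈ Icc 0 T) (V : Ω → Fin k → Fin 2 → ℝ) (hV : Measurable V)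
    (hind : IndepFun (fun ω i => X (s i) ω) V P) :
    (∫⁻ ω, ∏ i, r (X (s i) ω - V ω i) ∂P) ^ (1/2 : ℝ) ≤ auxG T k s := by
  have := h.prob
  set σ := Tuple.sort s
  have hmono : Monotone (s ∘ σ) := Tuple.monotone_sort s
  have hU : Measurable (fun ω i => X (s i) ω) := measurable_pi_lambda _ (fun i => h.meas _)
  rw [indepFun_iff_map_prod_eq_prod_map_map hU.aemeasurable hV.aemeasurable] at hind
  have hG : Measurable (fun p : (Fin k → Fin 2 → ℝ) × (Fin k → Fin 2 → ℝ) => ∏ i, r (p.1 i - p.2 i)) := by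
    fun_prop
  have key : ∫⁻ ω, ∏ i, r (X (s i) ω - V ω i) ∂P ≤ auxChain auxD k 0 (s ∘ σ) := by
    calc ∫⁻ ω, ∏ i, r (X (s i) ω - V ω i) ∂P
        = ∫⁻ v, ∫⁻ u, ∏ i, r (u i - v i) ∂(P.map (fun ω i => X (s i) ω)) ∂(P.map V) := by
          have hp : IsProbabilityMeasure (P.map V) := Measure.isProbabilityMeasure_map hV.aemeasurable
          have hp : IsProbabilityMeasure (P.map (fun ω i => X (s i) ω)) :=
            Measure.isProbabilityMeasure_map hU.aemeasurable
          rw [← lintegral_prod_symm' _ hG, ← hind, lintegral_map hG (hU.prodMk hV)]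
      _ ≤ ∫⁻ v, auxChain auxD k 0 (s ∘ σ) ∂(P.map V) := by
          refine lintegral_mono (fun v => ?_)
          dsimp only
          rw [lintegral_map (by fun_prop) hU]
          have := h.chain r hr hr1 k 0 le_rfl (s ∘ σ) hmono (fun i => (hs _).1) (fun i => (hs _).2)
            (v ∘ σ) (fun _ => 1) measurable_const
          simp only [one_mul, lintegral_one, measure_univ] at this
          refine le_trans (le_of_eq ?_) this
          refine lintegral_congr (fun ω => ?_)
          exact (Equiv.prod_comp σ (fun i => r (X (s i) ω - v i))).symm
      _ = _ := by
          have hp : IsProbabilityMeasure (P.map V) := Measure.isProbabilityMeasure_map hV.aemeasurable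
          simp
  calc _ ≤ (auxChain auxD k 0 (s ∘ σ)) ^ (1/2 : ℝ) := by gcongr
    _ = auxGs T k (s ∘ σ) := by
      rw [auxChain_sqrt k 0 _ hmono (fun i => (hs _).1), auxGs, indicator_of_mem]
      exact fun i => (hs _).2
    _ ≤ _ := Finset.single_le_sum (f := fun σ : Equiv.Perm (Fin k) => auxGs T k (s ∘ σ))
        (fun _ _ => zero_le) (Finset.mem_univ σ)

end


section
variable {Ω : Type*} [MeasurableSpace Ω]

lemma aux_pair_pointwise {P : Measure Ω} {T : ℝ} {X Y : ℝ → Ω → Fin 2 → ℝ} (hX : AuxGB P T X)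
    (hY : AuxGB P T Y) (hind : IndepFun (auxPath X T) (auxPath Y T) P)
    (r : (Fin 2 → ℝ) → ENNReal) (hr : Measurable r) (hr1 : ∫⁻ x, r x ≤ 1) (k : ℕ)
    (s u : Fin k → ℝ) (hs : ∀ i, s i ∈ Icc 0 T) (hu : ∀ i, u i ∈ Icc 0 T) :
    ∫⁻ ω, ∏ i, r (X (s i) ω - Y (u i) ω) ∂P ≤ auxG T k s * auxG T k u := by
  have hind2 : IndepFun (fun ω i => X (s i) ω) (fun ω i => Y (u i) ω) P := by
    have := hind.comp (φ := fun (p : Icc (0:ℝ) T × Fin 2 → ℝ) (i : Fin k) (j : Fin 2) => p (⟨s i, hs i⟩, j))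
      (ψ := fun (p : Icc (0:ℝ) T × Fin 2 → ℝ) (i : Fin k) (j : Fin 2) => p (⟨u i, hu i⟩, j))
      (measurable_pi_lambda _ fun _ => measurable_pi_lambda _ fun _ => measurable_pi_apply _)
      (measurable_pi_lambda _ fun _ => measurable_pi_lambda _ fun _ => measurable_pi_apply _)
    exact this
  have h1 := hX.half r hr hr1 k s hs _ (measurable_pi_lambda _ (fun i => hY.meas (u i))) hind2
  have h2 := hY.half (fun x => r (-x)) (by fun_prop) (by rwa [lintegral_neg_eq_self]) k u hu _
    (measurable_pi_lambda _ (fun i => hX.meas (s i))) hind2.symm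
  simp only [neg_sub] at h2
  refine le_trans (le_of_eq ?_) (mul_le_mul' h1 h2)
  rw [← ENNReal.rpow_add_of_nonneg _ _ (by norm_num) (by norm_num)]
  norm_num

lemma aux_joint {Ω : Type*} [MeasurableSpace Ω] {X : ℝ → Ω → Fin 2 → ℝ}
    (hm : ∀ s, Measurable (X s)) (hc : ∀ ω, Continuous (fun s => X s ω)) :
    Measurable (fun p : ℝ × Ω => X p.1 p.2) :=
  measurable_uncurry_of_continuous_of_measurable hc hm

noncomputable def auxAl {Ω : Type*} (r : (Fin 2 → ℝ) → ENNReal) (X Y : ℝ → Ω → Fin 2 → ℝ)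
    (A : Set (ℝ × ℝ)) (ω : Ω) : ENNReal := ∫⁻ p in A, r (X p.2 ω - Y p.1 ω)

lemma auxAl_meas {Ω : Type*} [MeasurableSpace Ω] {X Y : ℝ → Ω → Fin 2 → ℝ}
    (hm : ∀ s, Measurable (X s)) (hc : ∀ ω, Continuous (fun s => X s ω))
    (hmY : ∀ s, Measurable (Y s)) (hcY : ∀ ω, Continuous (fun s => Y s ω))
    (r : (Fin 2 → ℝ) → ENNReal) (hr : Measurable r) (A : Set (ℝ × ℝ)) :
    Measurable (auxAl r X Y A) := by
  unfold auxAl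
  apply Measurable.lintegral_prod_right'
    (f := fun q : Ω × (ℝ × ℝ) => r (X q.2.2 q.1 - Y q.2.1 q.1))
  refine hr.comp (Measurable.sub ?_ ?_)
  · exact (aux_joint hm hc).comp (by fun_prop : Measurable (fun q : Ω × (ℝ × ℝ) => (q.2.2, q.1)))
  · exact (aux_joint hmY hcY).comp (by fun_prop : Measurable (fun q : Ω × (ℝ × ℝ) => (q.2.1, q.1)))

lemma aux_moment {P : Measure Ω} {T : ℝ} (hT : 0 < T) {X Y : ℝ → Ω → Fin 2 → ℝ} (hX : AuxGB P T X)
    (hY : AuxGB P T Y) (hind : IndepFun (auxPath X T) (auxPath Y T) P)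
    (r : (Fin 2 → ℝ) → ENNReal) (hr : Measurable r) (hr1 : ∫⁻ x, r x ≤ 1)
    (A : Set (ℝ × ℝ)) (hA : MeasurableSet A) (hAT : A ⊆ Icc 0 T ×ˢ Icc 0 T) (k : ℕ) :
    ∫⁻ ω, (auxAl r X Y A ω) ^ k ∂P ≤ ENNReal.ofReal (k.factorial * (Real.exp 2 / 2 * T) ^ k) := by
  have := hX.prob
  have hj : Measurable (fun q : Ω × (ℝ × ℝ) => A.indicator (fun p => r (X p.2 q.1 - Y p.1 q.1)) q.2) := by
    have h0 : Measurable (fun q : Ω × (ℝ × ℝ) => r (X q.2.2 q.1 - Y q.2.1 q.1)) := by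
      refine hr.comp (Measurable.sub ?_ ?_)
      · exact (aux_joint hX.meas hX.cont).comp
          (by fun_prop : Measurable (fun q : Ω × (ℝ × ℝ) => (q.2.2, q.1)))
      · exact (aux_joint hY.meas hY.cont).comp
          (by fun_prop : Measurable (fun q : Ω × (ℝ × ℝ) => (q.2.1, q.1)))
    exact h0.indicator (measurable_snd hA)
  have e1 : ∀ ω, (auxAl r X Y A ω) ^ k =
      ∫⁻ x : Fin k → ℝ × ℝ, ∏ i, A.indicator (fun p => r (X p.2 ω - Y p.1 ω)) (x i) := by
    intro ω
    rw [auxAl, ← lintegral_indicator hA]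
    exact aux_lintegral_pow k _ (hj.comp (by fun_prop : Measurable (fun p : ℝ × ℝ => (ω, p))))
  simp only [e1]
  rw [lintegral_lintegral_swap]
  swap
  · refine (Finset.measurable_prod _ (fun i _ => ?_)).aemeasurable
    exact hj.comp (by fun_prop : Measurable (fun q : Ω × (Fin k → ℝ × ℝ) => (q.1, q.2 i)))
  calc _ ≤ ∫⁻ x : Fin k → ℝ × ℝ, (auxG T k (fun i => (x i).2) * auxG T k (fun i => (x i).1)) := by
        refine lintegral_mono (fun x => ?_)
        dsimp only
        by_cases hx : ∀ i, x i ∈ A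
        · simp only [indicator_of_mem (hx _)]
          exact aux_pair_pointwise hX hY hind r hr hr1 k _ _ (fun i => (hAT (hx i)).2)
            (fun i => (hAT (hx i)).1)
        · push Not at hx
          obtain ⟨i, hi⟩ := hx
          have : ∀ ω, ∏ i, A.indicator (fun p => r (X p.2 ω - Y p.1 ω)) (x i) = 0 := by
            intro ω
            exact Finset.prod_eq_zero (Finset.mem_univ i) (indicator_of_notMem hi _)
          simp [this]
    _ = ∫⁻ q : (Fin k → ℝ) × (Fin k → ℝ), auxG T k q.2 * auxG T k q.1 := by
        rw [← (volume_measurePreserving_arrowProdEquivProdArrow ℝ ℝ (Fin k)).lintegral_comp]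
        · rfl
        · exact ((auxG_meas T k).comp measurable_snd).mul ((auxG_meas T k).comp measurable_fst)
    _ = (∫⁻ s, auxG T k s) ^ 2 := by
        rw [Measure.volume_eq_prod]
        simp only [mul_comm (auxG T k (Prod.snd _))]
        rw [lintegral_prod_mul (auxG_meas T k).aemeasurable (auxG_meas T k).aemeasurable, sq]
    _ ≤ _ := auxG_final T hT k

lemma aux_exp {P : Measure Ω} [IsProbabilityMeasure P] (f : Ω → ENNReal) (hf : Measurable f)
    (b : ℝ) (hb : 0 ≤ b)
    (hmom : ∀ k : ℕ, ∫⁻ ω, f ω ^ k ∂P ≤ ENNReal.ofReal (k.factorial * b ^ k))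
    (hfin : ∀ ω, f ω ≠ ⊤) (κ : ℝ) (hκ : 0 ≤ κ) (hz : κ * b ≤ 1/2) :
    ∫⁻ ω, ENNReal.ofReal (Real.exp (κ * ((f ω).toReal - (∫⁻ ω, f ω ∂P).toReal))) ∂P
      ≤ ENNReal.ofReal (Real.exp (2 * (κ * b) ^ 2)) := by
  set m := (∫⁻ ω, f ω ∂P).toReal with hm
  have hmfin : ∫⁻ ω, f ω ∂P ≠ ⊤ := by
    have := hmom 1
    simp only [pow_one] at this
    exact ne_top_of_le_ne_top ENNReal.ofReal_ne_top this
  have hm0 : 0 ≤ m := ENNReal.toReal_nonneg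
  set z := κ * b with hzdef
  have hz0 : 0 ≤ z := mul_nonneg hκ hb
  have e1 : ∀ ω, ENNReal.ofReal (Real.exp (κ * ((f ω).toReal - m))) =
      ENNReal.ofReal (Real.exp (-(κ * m))) *
        ∑' k : ℕ, ENNReal.ofReal (κ ^ k / k.factorial) * f ω ^ k := by
    intro ω
    have : κ * ((f ω).toReal - m) = -(κ * m) + κ * (f ω).toReal := by ring
    rw [this, Real.exp_add, ENNReal.ofReal_mul (by positivity)]
    congr 1
    have hs := NormedSpace.expSeries_div_hasSum_exp (𝔸 := ℝ) (κ * (f ω).toReal)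
    rw [← Real.exp_eq_exp_ℝ] at hs
    rw [← hs.tsum_eq, ENNReal.ofReal_tsum_of_nonneg (fun n => by positivity) hs.summable]
    congr 1
    ext1 k
    nth_rewrite 2 [← ENNReal.ofReal_toReal (hfin ω)]
    rw [← ENNReal.ofReal_pow (by positivity), ← ENNReal.ofReal_mul (by positivity)]
    congr 1; ring
  simp only [e1]
  rw [lintegral_const_mul _ (Measurable.tsum (fun k => by fun_prop)),
    lintegral_tsum (fun k => by fun_prop)]
  have e2 : ∀ k : ℕ, ∫⁻ ω, ENNReal.ofReal (κ ^ k / k.factorial) * f ω ^ k ∂P ≤ ENNReal.ofReal (z ^ k) := by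
    intro k
    rw [lintegral_const_mul _ (by fun_prop)]
    calc _ ≤ ENNReal.ofReal (κ ^ k / k.factorial) * ENNReal.ofReal (k.factorial * b ^ k) := by
          gcongr; exact hmom k
      _ = _ := by
          rw [← ENNReal.ofReal_mul (by positivity)]
          congr 1
          rw [hzdef, mul_pow]; field_simp
  have hsum : ∑' k : ℕ, ∫⁻ ω, ENNReal.ofReal (κ ^ k / k.factorial) * f ω ^ k ∂P
      ≤ ENNReal.ofReal (1 + κ * m + 2 * z ^ 2) := by
    rw [tsum_eq_zero_add' ENNReal.summable, tsum_eq_zero_add' ENNReal.summable]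
    · have h2 : ∑' k : ℕ, ∫⁻ ω, ENNReal.ofReal (κ ^ (k+1+1) / (k+1+1).factorial) * f ω ^ (k+1+1) ∂P
          ≤ ENNReal.ofReal (2 * z ^ 2) := by
        calc _ ≤ ∑' k : ℕ, ENNReal.ofReal (z ^ (k+1+1)) := ENNReal.tsum_le_tsum (fun k => e2 _)
          _ = ENNReal.ofReal (∑' k : ℕ, z ^ (k+1+1)) := by
            rw [ENNReal.ofReal_tsum_of_nonneg (fun n => by positivity)]
            simp only [pow_succ, mul_assoc]
            exact (summable_geometric_of_lt_one hz0 (by linarith)).mul_right _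
          _ ≤ _ := by
            apply ENNReal.ofReal_le_ofReal
            simp only [pow_succ, mul_assoc]
            rw [tsum_mul_right, tsum_geometric_of_lt_one hz0 (by linarith)]
            have : (1 - z)⁻¹ ≤ 2 := by
              rw [inv_le_comm₀ (by linarith) (by norm_num)]; linarith
            nlinarith [mul_nonneg hz0 hz0]
      have h1 : ∫⁻ ω, ENNReal.ofReal (κ ^ (0+1) / (0+1).factorial) * f ω ^ (0+1) ∂P = ENNReal.ofReal (κ * m) := by
        simp only [zero_add, pow_one, Nat.factorial_one, Nat.cast_one, div_one]
        rw [lintegral_const_mul _ hf, ENNReal.ofReal_mul hκ, hm, ENNReal.ofReal_toReal hmfin]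
      rw [h1]
      have h0 : ∫⁻ ω, ENNReal.ofReal (κ ^ 0 / (0).factorial) * f ω ^ 0 ∂P = ENNReal.ofReal 1 := by simp
      rw [h0, add_assoc 1, ENNReal.ofReal_add (by norm_num) (by positivity),
        ENNReal.ofReal_add (by positivity) (by positivity)]
      gcongr
  refine (mul_le_mul_right hsum _).trans ?_
  rw [← ENNReal.ofReal_mul (by positivity)]
  apply ENNReal.ofReal_le_ofReal
  have a1 : 1 + κ * m ≤ Real.exp (κ * m) := by linarith [Real.add_one_le_exp (κ * m)]
  have a2 : 1 + 2 * z^2 ≤ Real.exp (2 * z^2) := by linarith [Real.add_one_le_exp (2 * z^2)]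
  have a3 : Real.exp (-(κ * m)) ≤ 1 := Real.exp_le_one_iff.2 (by nlinarith [mul_nonneg hκ hm0])
  have a4 : Real.exp (-(κ * m)) * Real.exp (κ * m) = 1 := by rw [← Real.exp_add]; simp
  have a5 := Real.exp_pos (-(κ * m))
  calc _ ≤ Real.exp (-(κ * m)) * (Real.exp (κ * m) + 2 * z^2) := by gcongr
    _ = 1 + Real.exp (-(κ * m)) * (2 * z^2) := by rw [mul_add, a4]
    _ ≤ 1 + 1 * (2 * z^2) := by gcongr
    _ ≤ _ := by linarith

end


section
variable {Ω : Type*} [MeasurableSpace Ω]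

lemma AuxGB.restr {P : Measure Ω} {T : ℝ} {X : ℝ → Ω → Fin 2 → ℝ} (h : AuxGB P T X) {a : ℝ}
    (ha : a ≤ T) : AuxGB P a X :=
  { h with cov := fun s t hs ht => h.cov s t ⟨hs.1, hs.2.trans ha⟩ ⟨ht.1, ht.2.trans ha⟩ }

lemma AuxGB.tr {P : Measure Ω} {T : ℝ} {X : ℝ → Ω → Fin 2 → ℝ} (h : AuxGB P T X)
    (g : ℝ → ℝ) (hg : Continuous g) (c a : ℝ) (hc : c ∈ Icc 0 T)
    (hgm : ∀ s ∈ Icc 0 a, g s ∈ Icc 0 T)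
    (hcov : ∀ s ∈ Icc 0 a, ∀ t ∈ Icc 0 a, min (g s) (g t) - min (g s) c - min c (g t) + c = min s t) :
    AuxGB P a (fun s ω => X (g s) ω - X c ω) := by
  have := h.prob
  have hL : ∀ t i, MemLp (fun ω => X t ω i) 2 P := fun t i => (h.gp.hasGaussianLaw_eval (t,i)).memLp_two
  refine ⟨h.prob, fun s => (h.meas _).sub (h.meas _), fun ω => ((h.cont ω).comp hg).sub continuous_const,
    ?_, ?_, ?_⟩
  · simpa using aux_gauss_comb h.gp (fun q : ℝ × Fin 2 => (g q.1, q.2)) (fun q => (c, q.2)) (fun _ => 1)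
  · intro s i
    simp only [Pi.sub_apply]
    rw [integral_sub ((hL _ i).integrable (by norm_num)) ((hL _ i).integrable (by norm_num)), h.mean, h.mean]
    simp
  · intro s t hs ht i j
    have := aux_cov_expand (hL (g s) i) (hL c i) (hL (g t) j) (hL c j) 1 1
    simp only [one_mul] at this
    simp only [Pi.sub_apply]
    rw [this, h.cov _ _ (hgm s hs) (hgm t ht), h.cov _ _ (hgm s hs) hc, h.cov _ _ hc (hgm t ht),
      h.cov _ _ hc hc]
    split_ifs
    · rw [min_self]; exact hcov s hs t ht
    · simp

lemma aux_ltSet_meas (T : ℝ) : MeasurableSet (ltSet T) := by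
  unfold ltSet
  apply MeasurableSet.inter (measurableSet_le measurable_const measurable_fst)
  apply MeasurableSet.inter (measurableSet_lt measurable_fst measurable_snd)
  exact (measurableSet_le measurable_snd measurable_const)

lemma aux_ltSet_sub (T : ℝ) : ltSet T ⊆ Icc 0 T ×ˢ Icc 0 T := by
  rintro ⟨u, s⟩ ⟨h1, h2, h3⟩
  dsimp only at h1 h2 h3
  exact ⟨⟨h1, by dsimp only; linarith⟩, ⟨by dsimp only; linarith, h3⟩⟩

lemma auxAl_ltSet_measF {Ω : Type*} {X : ℝ → Ω → Fin 2 → ℝ} {T : ℝ} (hT : 0 ≤ T)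
    (hc : ∀ ω, Continuous (fun s => X s ω)) (r : (Fin 2 → ℝ) → ENNReal) (hr : Measurable r) :
    Measurable[auxF X T] (auxAl r X X (ltSet T)) := by
  have hcl : ∀ s, max 0 (min s T) ∈ Icc 0 T := fun s => ⟨le_max_left _ _, max_le hT (min_le_right _ _)⟩
  have e : auxAl r X X (ltSet T) = auxAl r (fun s => X (max 0 (min s T))) (fun s => X (max 0 (min s T))) (ltSet T) := by
    ext ω
    unfold auxAl
    refine setLIntegral_congr_fun (aux_ltSet_meas T) (fun p hp => ?_)
    have := aux_ltSet_sub T hp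
    obtain ⟨⟨h1, h2⟩, h3, h4⟩ := this
    simp [h1, h2, h3, h4]
  rw [e]
  have hcont : ∀ ω, Continuous (fun s => X (max 0 (min s T)) ω) := fun ω => (hc ω).comp (by fun_prop)
  exact @auxAl_meas Ω (auxF X T) _ _ (fun s => auxF_eval X T _ (hcl s)) hcont
    (fun s => auxF_eval X T _ (hcl s)) hcont r hr _

lemma auxAl_bdd {Ω : Type*} {X Y : ℝ → Ω → Fin 2 → ℝ} {T : ℝ} (hT : 0 ≤ T)
    (r : (Fin 2 → ℝ) → ENNReal) (M : ℝ) (hM : 0 ≤ M) (hrM : ∀ x, r x ≤ ENNReal.ofReal M)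
    (A : Set (ℝ × ℝ)) (hAT : A ⊆ Icc 0 T ×ˢ Icc 0 T) (ω : Ω) :
    auxAl r X Y A ω ≤ ENNReal.ofReal (M * T ^ 2) := by
  unfold auxAl
  calc _ ≤ ∫⁻ p in Icc 0 T ×ˢ Icc 0 T, ENNReal.ofReal M :=
        (lintegral_mono_set hAT).trans (lintegral_mono fun p => hrM _)
    _ = _ := by
      rw [setLIntegral_const, Measure.volume_eq_prod, Measure.prod_prod, Real.volume_Icc,
        ← ENNReal.ofReal_mul (by linarith), ← ENNReal.ofReal_mul hM]
      congr 1; ring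

lemma auxAl_split {Ω : Type*} [MeasurableSpace Ω] {X : ℝ → Ω → Fin 2 → ℝ} (h : ℝ) (hh : 0 < h)
    (hc : ∀ ω, Continuous (fun s => X s ω)) (r : (Fin 2 → ℝ) → ENNReal) (hr : Measurable r) (ω : Ω) :
    auxAl r X X (ltSet (2 * h)) ω = auxAl r X X (ltSet h) ω +
      auxAl r (fun s ω => X (h + s) ω - X h ω) (fun s ω => X (h + s) ω - X h ω) (ltSet h) ω +
      auxAl r (fun s ω => X (h + s) ω - X h ω) (fun s ω => X (h - s) ω - X h ω) (Ioc 0 h ×ˢ Ioc 0 h) ω := by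
  unfold auxAl
  simp only [sub_sub_sub_cancel_right]
  have hm : Measurable (fun p : ℝ × ℝ => r (X p.2 ω - X p.1 ω)) := by
    refine hr.comp (Measurable.sub ?_ ?_)
    · exact ((hc ω).comp continuous_snd).measurable
    · exact ((hc ω).comp continuous_fst).measurable
  have m1 : MeasurableSet {p : ℝ × ℝ | h ≤ p.1 ∧ p.1 < p.2 ∧ p.2 ≤ 2 * h} := by
    apply MeasurableSet.inter (measurableSet_le measurable_const measurable_fst)
    apply MeasurableSet.inter (measurableSet_lt measurable_fst measurable_snd)
    exact (measurableSet_le measurable_snd measurable_const)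
  have m2 : MeasurableSet (Ico 0 h ×ˢ Ioc h (2 * h)) := measurableSet_Ico.prod measurableSet_Ioc
  have e : ltSet (2 * h) = (ltSet h ∪ {p : ℝ × ℝ | h ≤ p.1 ∧ p.1 < p.2 ∧ p.2 ≤ 2 * h}) ∪
      (Ico 0 h ×ˢ Ioc h (2 * h)) := by
    ext ⟨u, s⟩
    simp only [ltSet, mem_ofPred_eq, mem_union, mem_prod, mem_Ico, mem_Ioc]
    constructor
    · rintro ⟨h1, h2, h3⟩
      rcases le_or_gt s h with h4 | h4
      · left; left; exact ⟨h1, h2, h4⟩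
      · rcases le_or_gt h u with h5 | h5
        · left; right; exact ⟨h5, h2, h3⟩
        · right; exact ⟨⟨h1, h5⟩, h4, h3⟩
    · rintro ((⟨h1, h2, h3⟩ | ⟨h1, h2, h3⟩) | ⟨⟨h1, h2⟩, h3, h4⟩) <;>
        exact ⟨by linarith, by linarith, by linarith⟩
  have d1 : Disjoint (ltSet h) {p : ℝ × ℝ | h ≤ p.1 ∧ p.1 < p.2 ∧ p.2 ≤ 2 * h} := by
    rw [Set.disjoint_left]
    rintro ⟨u, s⟩ ⟨h1, h2, h3⟩ ⟨h4, h5, h6⟩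
    dsimp only at *
    linarith
  have d2 : Disjoint (ltSet h ∪ {p : ℝ × ℝ | h ≤ p.1 ∧ p.1 < p.2 ∧ p.2 ≤ 2 * h})
      (Ico 0 h ×ˢ Ioc h (2 * h)) := by
    rw [Set.disjoint_left]
    rintro ⟨u, s⟩ (⟨h1, h2, h3⟩ | ⟨h1, h2, h3⟩) ⟨⟨h4, h5⟩, h6, h7⟩ <;> dsimp only at * <;> linarith
  rw [e, lintegral_union m2 d2, lintegral_union m1 d1]
  congr 1
  · congr 1
    have mp : MeasurePreserving (fun p : ℝ × ℝ => (h + p.1, h + p.2)) volume volume :=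
      (measurePreserving_add_left volume h).prod (measurePreserving_add_left volume h)
    rw [← mp.setLIntegral_comp_preimage m1 hm]
    congr 2
    ext ⟨u, s⟩
    simp only [ltSet, mem_preimage, mem_ofPred_eq]
    constructor <;> rintro ⟨h1, h2, h3⟩ <;> exact ⟨by linarith, by linarith, by linarith⟩
  · have mp : MeasurePreserving (fun p : ℝ × ℝ => (h - p.1, h + p.2)) volume volume :=
      (Measure.measurePreserving_sub_left volume h).prod (measurePreserving_add_left volume h)
    rw [← mp.setLIntegral_comp_preimage m2 hm]
    congr 2
    ext ⟨u, s⟩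
    simp only [mem_preimage, mem_prod, mem_Ico, mem_Ioc]
    constructor <;> rintro ⟨⟨h1, h2⟩, h3, h4⟩ <;>
      exact ⟨⟨by linarith, by linarith⟩, by linarith, by linarith⟩

noncomputable def auxNu (r : (Fin 2 → ℝ) → ENNReal) (T : ℝ) : ENNReal :=
  ∫⁻ p in ltSet T, ∫⁻ x, r x * ENNReal.ofReal (heatKernel (p.2 - p.1) x)

lemma AuxGB.nu {P : Measure Ω} {T : ℝ} {X : ℝ → Ω → Fin 2 → ℝ} (h : AuxGB P T X)
    (r : (Fin 2 → ℝ) → ENNReal) (hr : Measurable r) :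
    ∫⁻ ω, auxAl r X X (ltSet T) ω ∂P = auxNu r T := by
  have := h.prob
  unfold auxAl auxNu
  rw [lintegral_lintegral_swap]
  swap
  · refine Measurable.aemeasurable ?_
    refine hr.comp (Measurable.sub ?_ ?_)
    · exact (aux_joint h.meas h.cont).comp
        (by fun_prop : Measurable (fun q : Ω × (ℝ × ℝ) => (q.2.2, q.1)))
    · exact (aux_joint h.meas h.cont).comp
        (by fun_prop : Measurable (fun q : Ω × (ℝ × ℝ) => (q.2.1, q.1)))
  refine setLIntegral_congr_fun (aux_ltSet_meas T) (fun p hp => ?_)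
  obtain ⟨h1, h2, h3⟩ := hp
  rw [← lintegral_map (f := r) (g := fun ω => X p.2 ω - X p.1 ω) hr ((h.meas _).sub (h.meas _)),
    h.law _ _ h1 h2.le h3, aux_gauss_lintegral]
  · rw [Real.coe_toNNReal _ (by linarith)]
  · simpa using h2
  · exact hr

lemma aux_exp_rpow (x y : ℝ) : (ENNReal.ofReal (Real.exp x)) ^ y = ENNReal.ofReal (Real.exp (x * y)) := by
  rw [ENNReal.ofReal_rpow_of_pos (Real.exp_pos x), Real.exp_mul]

end


section
variable {Ω : Type*} [MeasurableSpace Ω]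

lemma AuxGB.indep_shift {P : Measure Ω} {h : ℝ} (hh : 0 < h) {X : ℝ → Ω → Fin 2 → ℝ} (H : AuxGB P (2*h) X) :
    IndepFun (auxPath X h) (auxPath (fun s ω => X (h + s) ω - X h ω) h) P := by
  have := aux_indep_comb H.gp (fun q : Icc (0:ℝ) h × Fin 2 => ((q.1 : ℝ), q.2)) (fun q => (0, 0)) (fun _ => 0)
    (fun q : Icc (0:ℝ) h × Fin 2 => (h + (q.1 : ℝ), q.2)) (fun q => (h, q.2)) (fun _ => 1) ?_
  · simp only [zero_mul, sub_zero, one_mul] at this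
    exact this
  · rintro ⟨⟨s, h1, h2⟩, i⟩ ⟨⟨u, h3, h4⟩, j⟩
    dsimp only
    rw [H.cov _ _ (by constructor <;> linarith) (by constructor <;> linarith),
      H.cov _ _ (by constructor <;> linarith) (by constructor <;> linarith)]
    rw [min_eq_left (by linarith), min_eq_left h2]
    split_ifs <;> simp

lemma AuxGB.indep_rev {P : Measure Ω} {h : ℝ} (hh : 0 < h) {X : ℝ → Ω → Fin 2 → ℝ} (H : AuxGB P (2*h) X) :
    IndepFun (auxPath (fun s ω => X (h + s) ω - X h ω) h) (auxPath (fun s ω => X (h - s) ω - X h ω) h) P := by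
  have := aux_indep_comb H.gp 
    (fun q : Icc (0:ℝ) h × Fin 2 => (h + (q.1 : ℝ), q.2)) (fun q => (h, q.2)) (fun _ => 1)
    (fun q : Icc (0:ℝ) h × Fin 2 => (h - (q.1 : ℝ), q.2)) (fun q => (h, q.2)) (fun _ => 1) ?_
  · simp only [one_mul] at this
    exact this
  · rintro ⟨⟨s, h1, h2⟩, i⟩ ⟨⟨u, h3, h4⟩, j⟩
    dsimp only
    rw [H.cov _ _ (by constructor <;> linarith) (by constructor <;> linarith),
      H.cov _ _ (by constructor <;> linarith) (by constructor <;> linarith),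
      H.cov _ _ (by constructor <;> linarith) (by constructor <;> linarith),
      H.cov _ _ (by constructor <;> linarith) (by constructor <;> linarith)]
    rw [min_eq_right (by linarith), min_eq_right (by linarith), min_eq_right (by linarith), min_self]
    split_ifs <;> ring

lemma AuxGB.shift {P : Measure Ω} {h : ℝ} (hh : 0 < h) {X : ℝ → Ω → Fin 2 → ℝ} (H : AuxGB P (2*h) X) :
    AuxGB P h (fun s ω => X (h + s) ω - X h ω) := by
  refine H.tr (fun s => h + s) (by fun_prop) h h (by constructor <;> linarith) ?_ ?_
  · rintro s ⟨h1, h2⟩; constructor <;> linarith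
  · rintro s ⟨h1, h2⟩ t ⟨h3, h4⟩
    rw [min_add_add_left, min_eq_right (by linarith : h ≤ h + s), min_eq_left (by linarith : h ≤ h + t)]
    ring

lemma AuxGB.rev {P : Measure Ω} {h : ℝ} (hh : 0 < h) {X : ℝ → Ω → Fin 2 → ℝ} (H : AuxGB P (2*h) X) :
    AuxGB P h (fun s ω => X (h - s) ω - X h ω) := by
  refine H.tr (fun s => h - s) (by fun_prop) h h (by constructor <;> linarith) ?_ ?_
  · rintro s ⟨h1, h2⟩; constructor <;> linarith
  · rintro s ⟨h1, h2⟩ t ⟨h3, h4⟩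
    rw [min_eq_left (by linarith : h - s ≤ h), min_eq_right (by linarith : h - t ≤ h)]
    rcases le_total s t with hst | hst
    · rw [min_eq_left hst, min_eq_right (by linarith)]; ring
    · rw [min_eq_right hst, min_eq_left (by linarith)]; ring

lemma AuxGB.main {P : Measure Ω} {r : (Fin 2 → ℝ) → ENNReal} (hr : Measurable r) (hr1 : ∫⁻ x, r x ≤ 1)
    (M : ℝ) (hM : 0 ≤ M) (hrM : ∀ x, r x ≤ ENNReal.ofReal M) (J : ℕ) :
    ∀ (T : ℝ) (κ : ℝ) (X : ℝ → Ω → Fin 2 → ℝ), 0 < T → 0 ≤ κ → κ * (Real.exp 2 / 2 * T) ≤ 1 / 3 →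
      AuxGB P T X →
      ∫⁻ ω, ENNReal.ofReal (Real.exp (κ * ((auxAl r X X (ltSet T) ω).toReal - (auxNu r T).toReal))) ∂P
        ≤ ENNReal.ofReal (Real.exp (6 * (κ * (Real.exp 2 / 2 * T)) ^ 2 + κ * M * T ^ 2 / 2 ^ J)) := by
  induction J with
  | zero =>
    intro T κ X hT hκ hκT H
    have := H.prob
    calc _ ≤ ∫⁻ ω, ENNReal.ofReal (Real.exp (6 * (κ * (Real.exp 2 / 2 * T)) ^ 2 + κ * M * T ^ 2 / 2 ^ 0)) ∂P := by
          refine lintegral_mono (fun ω => ?_)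
          apply ENNReal.ofReal_le_ofReal
          apply Real.exp_le_exp.2
          have h1 : (auxAl r X X (ltSet T) ω).toReal ≤ M * T ^ 2 :=
            ENNReal.toReal_le_of_le_ofReal (by positivity) (auxAl_bdd hT.le r M hM hrM _ (aux_ltSet_sub T) ω)
          have h2 : 0 ≤ (auxNu r T).toReal := ENNReal.toReal_nonneg
          have h3 : κ * ((auxAl r X X (ltSet T) ω).toReal - (auxNu r T).toReal) ≤ κ * (M * T^2) := by
            gcongr; linarith
          have h4 : 0 ≤ 6 * (κ * (Real.exp 2 / 2 * T)) ^ 2 := by positivity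
          rw [pow_zero]
          linarith
      _ = _ := by simp
  | succ J ih =>
    intro T κ X hT hκ hκT H0
    have := H0.prob
    obtain ⟨h, rfl⟩ : ∃ h, T = 2 * h := ⟨T / 2, by ring⟩
    have hh : 0 < h := by linarith
    have H : AuxGB P (2 * h) X := H0
    have H1 : AuxGB P h X := H.restr (by linarith)
    set X' : ℝ → Ω → Fin 2 → ℝ := fun s ω => X (h + s) ω - X h ω with hX'
    set Y' : ℝ → Ω → Fin 2 → ℝ := fun s ω => X (h - s) ω - X h ω with hY'
    have H2 : AuxGB P h X' := H.shift hh
    have H3 : AuxGB P h Y' := H.rev hh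
    have hIsub : Ioc 0 h ×ˢ Ioc 0 h ⊆ Icc 0 h ×ˢ Icc 0 h := prod_mono Ioc_subset_Icc_self Ioc_subset_Icc_self
    set b1 := auxAl r X X (ltSet h) with hb1
    set b2 := auxAl r X' X' (ltSet h) with hb2
    set al := auxAl r X' Y' (Ioc 0 h ×ˢ Ioc 0 h) with hal
    have hsplit : ∀ ω, auxAl r X X (ltSet (2 * h)) ω = b1 ω + b2 ω + al ω :=
      fun ω => auxAl_split h hh H.cont r hr ω
    have f1 : ∀ ω, b1 ω ≠ ⊤ := fun ω =>
      ne_top_of_le_ne_top ENNReal.ofReal_ne_top (auxAl_bdd hh.le r M hM hrM _ (aux_ltSet_sub h) ω)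
    have f2 : ∀ ω, b2 ω ≠ ⊤ := fun ω =>
      ne_top_of_le_ne_top ENNReal.ofReal_ne_top (auxAl_bdd hh.le r M hM hrM _ (aux_ltSet_sub h) ω)
    have f3 : ∀ ω, al ω ≠ ⊤ := fun ω =>
      ne_top_of_le_ne_top ENNReal.ofReal_ne_top (auxAl_bdd hh.le r M hM hrM _ hIsub ω)
    have m1F : Measurable[auxF X h] b1 := auxAl_ltSet_measF hh.le H1.cont r hr
    have m2F : Measurable[auxF X' h] b2 := auxAl_ltSet_measF hh.le H2.cont r hr
    have m1 : Measurable b1 := m1F.mono (auxF_le H1.meas h) le_rfl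
    have m2 : Measurable b2 := m2F.mono (auxF_le H2.meas h) le_rfl
    have m3 : Measurable al := auxAl_meas H2.meas H2.cont H3.meas H3.cont r hr _
    have hmom := aux_moment hh H2 H3 (H.indep_rev hh) r hr hr1 (Ioc 0 h ×ˢ Ioc 0 h)
      (measurableSet_Ioc.prod measurableSet_Ioc) hIsub
    have hnu : (auxNu r (2 * h)).toReal = (auxNu r h).toReal + (auxNu r h).toReal + (∫⁻ ω, al ω ∂P).toReal := by
      have e1 : auxNu r (2 * h) = auxNu r h + auxNu r h + ∫⁻ ω, al ω ∂P := by
        rw [← H.nu r hr]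
        simp only [hsplit]
        rw [lintegral_add_right _ m3, lintegral_add_right _ m2, hb1, hb2, H1.nu r hr, H2.nu r hr]
      have hf : auxNu r h ≠ ⊤ := by
        rw [← H1.nu r hr]
        refine ne_top_of_le_ne_top (b := ENNReal.ofReal (M * h ^ 2)) ENNReal.ofReal_ne_top ?_
        calc _ ≤ ∫⁻ ω, ENNReal.ofReal (M * h ^ 2) ∂P :=
              lintegral_mono (fun ω => auxAl_bdd hh.le r M hM hrM _ (aux_ltSet_sub h) ω)
          _ = _ := by simp
      have hf3 : ∫⁻ ω, al ω ∂P ≠ ⊤ := by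
        have := hmom 1
        simp only [pow_one] at this
        exact ne_top_of_le_ne_top ENNReal.ofReal_ne_top this
      rw [e1, ENNReal.toReal_add (by simp [hf]) hf3, ENNReal.toReal_add hf hf]
    set ν := (auxNu r h).toReal with hν
    set a := (∫⁻ ω, al ω ∂P).toReal with ha
    have key : ∀ ω, ENNReal.ofReal (Real.exp (κ * ((auxAl r X X (ltSet (2 * h)) ω).toReal - (auxNu r (2 * h)).toReal)))
      = (ENNReal.ofReal (Real.exp (κ * ((b1 ω).toReal - ν))) * ENNReal.ofReal (Real.exp (κ * ((b2 ω).toReal - ν))))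
        * ENNReal.ofReal (Real.exp (κ * ((al ω).toReal - a))) := by
      intro ω
      rw [← ENNReal.ofReal_mul (by positivity), ← ENNReal.ofReal_mul (by positivity), ← Real.exp_add,
        ← Real.exp_add, hsplit, hnu, ENNReal.toReal_add (by simp [f1, f2]) (f3 ω), ENNReal.toReal_add (f1 ω) (f2 ω)]
      congr 2; ring
    simp only [key]
    have hpq : (3/2 : ℝ).HolderConjugate 3 := by
      rw [Real.holderConjugate_iff]; norm_num
    have hol := ENNReal.lintegral_mul_le_Lp_mul_Lq P hpq
      (f := fun ω => ENNReal.ofReal (Real.exp (κ * ((b1 ω).toReal - ν))) * ENNReal.ofReal (Real.exp (κ * ((b2 ω).toReal - ν))))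
      (g := fun ω => ENNReal.ofReal (Real.exp (κ * ((al ω).toReal - a)))) (by fun_prop) (by fun_prop)
    refine (le_of_eq ?_).trans (hol.trans ?_)
    · rfl
    simp only [ENNReal.mul_rpow_of_nonneg _ _ (by norm_num : (0:ℝ) ≤ 3/2), aux_exp_rpow]
    have hprod : ∫⁻ ω, ENNReal.ofReal (Real.exp (κ * ((b1 ω).toReal - ν) * (3/2))) *
        ENNReal.ofReal (Real.exp (κ * ((b2 ω).toReal - ν) * (3/2))) ∂P =
        (∫⁻ ω, ENNReal.ofReal (Real.exp (κ * ((b1 ω).toReal - ν) * (3/2))) ∂P) *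
        ∫⁻ ω, ENNReal.ofReal (Real.exp (κ * ((b2 ω).toReal - ν) * (3/2))) ∂P := by
      have hi := H.indep_shift hh
      rw [IndepFun_iff_Indep] at hi
      have g : Measurable (fun x : ENNReal => ENNReal.ofReal (Real.exp (κ * (x.toReal - ν) * (3/2)))) := by
        fun_prop
      exact lintegral_mul_eq_lintegral_mul_lintegral_of_independent_measurableSpace
        (auxF_le H1.meas h) (auxF_le H2.meas h) hi (g.comp m1F) (g.comp m2F)
    rw [hprod]
    set A := 6 * (κ * (3/2) * (Real.exp 2 / 2 * h)) ^ 2 + κ * (3/2) * M * h ^ 2 / 2 ^ J with hA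
    have hκ' : κ * (3/2) * (Real.exp 2 / 2 * h) ≤ 1 / 3 := by
      have : 0 ≤ κ * (Real.exp 2 / 2 * h) := by positivity
      nlinarith
    have i1 : ∫⁻ ω, ENNReal.ofReal (Real.exp (κ * ((b1 ω).toReal - ν) * (3/2))) ∂P ≤ ENNReal.ofReal (Real.exp A) := by
      have := ih h (κ * (3/2)) X hh (by positivity) hκ' H1
      refine (le_of_eq ?_).trans this
      congr 1; ext1 ω; congr 2; ring
    have i2 : ∫⁻ ω, ENNReal.ofReal (Real.exp (κ * ((b2 ω).toReal - ν) * (3/2))) ∂P ≤ ENNReal.ofReal (Real.exp A) := by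
      have := ih h (κ * (3/2)) X' hh (by positivity) hκ' H2
      refine (le_of_eq ?_).trans this
      congr 1; ext1 ω; congr 2; ring
    have i3 : ∫⁻ ω, ENNReal.ofReal (Real.exp (κ * ((al ω).toReal - a) * 3)) ∂P ≤
        ENNReal.ofReal (Real.exp (2 * (κ * 3 * (Real.exp 2 / 2 * h)) ^ 2)) := by
      have := aux_exp (P := P) al m3 (Real.exp 2 / 2 * h) (by positivity) hmom f3 (κ * 3) (by positivity)
        (by nlinarith)
      refine (le_of_eq ?_).trans this
      congr 1; ext1 ω; congr 2; ring
    calc _ ≤ (ENNReal.ofReal (Real.exp A) * ENNReal.ofReal (Real.exp A)) ^ (1 / (3/2 : ℝ)) *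
          ENNReal.ofReal (Real.exp (2 * (κ * 3 * (Real.exp 2 / 2 * h)) ^ 2)) ^ (1 / (3:ℝ)) := by
          gcongr
      _ = _ := by
          rw [← ENNReal.ofReal_mul (by positivity), ← Real.exp_add, aux_exp_rpow, aux_exp_rpow,
            ← ENNReal.ofReal_mul (by positivity), ← Real.exp_add]
          congr 2
          rw [hA]; field_simp; ring

lemma AuxGB.beta {P : Measure Ω} {r : (Fin 2 → ℝ) → ENNReal} (hr : Measurable r) (hr1 : ∫⁻ x, r x ≤ 1)
    (M : ℝ) (hM : 0 ≤ M) (hrM : ∀ x, r x ≤ ENNReal.ofReal M)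
    {T : ℝ} {κ : ℝ} {X : ℝ → Ω → Fin 2 → ℝ} (hT : 0 < T) (hκ : 0 ≤ κ)
    (hκT : κ * (Real.exp 2 / 2 * T) ≤ 1 / 3) (H : AuxGB P T X) :
      ∫⁻ ω, ENNReal.ofReal (Real.exp (κ * ((auxAl r X X (ltSet T) ω).toReal - (auxNu r T).toReal))) ∂P
        ≤ ENNReal.ofReal (Real.exp 1) := by
  have h1 := fun J => AuxGB.main (P := P) hr hr1 M hM hrM J T κ X hT hκ hκT H
  have h2 : Tendsto (fun J : ℕ => ENNReal.ofReal (Real.exp (6 * (κ * (Real.exp 2 / 2 * T)) ^ 2 + κ * M * T ^ 2 / 2 ^ J)))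
      atTop (nhds (ENNReal.ofReal (Real.exp (6 * (κ * (Real.exp 2 / 2 * T)) ^ 2 + 0)))) := by
    refine ENNReal.tendsto_ofReal ((Real.continuous_exp.tendsto _).comp (tendsto_const_nhds.add ?_))
    exact tendsto_const_nhds.div_atTop (tendsto_pow_atTop_atTop_of_one_lt (by norm_num))
  refine (ge_of_tendsto' h2 h1).trans ?_
  apply ENNReal.ofReal_le_ofReal
  apply Real.exp_le_exp.2
  have : 0 ≤ κ * (Real.exp 2 / 2 * T) := by positivity
  nlinarith

lemma AuxGB.alpha {P : Measure Ω} {r : (Fin 2 → ℝ) → ENNReal} (hr : Measurable r) (hr1 : ∫⁻ x, r x ≤ 1)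
    (M : ℝ) (hM : 0 ≤ M) (hrM : ∀ x, r x ≤ ENNReal.ofReal M)
    {T : ℝ} {κ : ℝ} {X Y : ℝ → Ω → Fin 2 → ℝ} (hT : 0 < T) (hκ : 0 ≤ κ)
    (hκT : κ * (Real.exp 2 / 2 * T) ≤ 1 / 3) (H : AuxGB P T X) (H' : AuxGB P T Y)
    (hind : IndepFun (auxPath X T) (auxPath Y T) P) :
      ∫⁻ ω, ENNReal.ofReal (Real.exp (κ * (auxAl r X Y (Icc 0 T ×ˢ Icc 0 T) ω).toReal)) ∂P
        ≤ ENNReal.ofReal (Real.exp 1) := by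
  have := H.prob
  have hmom := aux_moment hT H H' hind r hr hr1 (Icc 0 T ×ˢ Icc 0 T)
      (measurableSet_Icc.prod measurableSet_Icc) subset_rfl
  have h1 := aux_exp (P := P) _ (auxAl_meas H.meas H.cont H'.meas H'.cont r hr _)
    (Real.exp 2 / 2 * T) (by positivity) hmom 
    (fun ω => ne_top_of_le_ne_top ENNReal.ofReal_ne_top (auxAl_bdd hT.le r M hM hrM _ subset_rfl ω)) κ hκ
    (by linarith)
  set m := (∫⁻ ω, auxAl r X Y (Icc 0 T ×ˢ Icc 0 T) ω ∂P).toReal with hm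
  have hm1 : m ≤ Real.exp 2 / 2 * T := by
    have := hmom 1
    simp only [pow_one, Nat.factorial_one, Nat.cast_one, one_mul] at this
    exact ENNReal.toReal_le_of_le_ofReal (by positivity) this
  calc _ = ENNReal.ofReal (Real.exp (κ * m)) * ∫⁻ ω, ENNReal.ofReal (Real.exp (κ * ((auxAl r X Y (Icc 0 T ×ˢ Icc 0 T) ω).toReal - m))) ∂P := by
        rw [← lintegral_const_mul' _ _ ENNReal.ofReal_ne_top]
        congr 1; ext1 ω
        rw [← ENNReal.ofReal_mul (by positivity), ← Real.exp_add]
        congr 2; ring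
    _ ≤ ENNReal.ofReal (Real.exp (κ * m)) * ENNReal.ofReal (Real.exp (2 * (κ * (Real.exp 2 / 2 * T)) ^ 2)) := by
        gcongr
    _ ≤ _ := by
        rw [← ENNReal.ofReal_mul (by positivity), ← Real.exp_add]
        apply ENNReal.ofReal_le_ofReal
        apply Real.exp_le_exp.2
        have : 0 ≤ κ * (Real.exp 2 / 2 * T) := by positivity
        have : κ * m ≤ κ * (Real.exp 2 / 2 * T) := by gcongr
        nlinarith

end


structure AuxR (R : (Fin 2 → ℝ) → ℝ) : Prop where
  nonneg : ∀ x, 0 ≤ R x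
  cont : Continuous R
  bdd : ∃ M, 0 ≤ M ∧ ∀ x, R x ≤ M
  int : ∫⁻ x, ENNReal.ofReal (R x) ≤ 1

lemma aux_R {ρ R : (Fin 2 → ℝ) → ℝ} (hc : Continuous ρ) (h0 : ∀ x, 0 ≤ ρ x)
    (hs : HasCompactSupport ρ) (hi : (∫ x : Fin 2 → ℝ, ρ x) = 1)
    (hR : ∀ x, R x = ∫ y : Fin 2 → ℝ, ρ (x - y) * ρ y) : AuxR R := by
  have e : R = convolution ρ ρ (ContinuousLinearMap.mul ℝ ℝ) volume := by
    ext x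
    rw [hR, convolution_def]
    simp only [ContinuousLinearMap.mul_apply', mul_comm]
  have hnn : ∀ x, 0 ≤ R x := fun x => by
    rw [hR]; exact integral_nonneg (fun y => mul_nonneg (h0 _) (h0 _))
  have hcR : Continuous R := by
    rw [e]
    exact hs.continuous_convolution_right _ hc.locallyIntegrable hc
  have hsR : HasCompactSupport R := by
    rw [e]; exact hs.convolution _ hs
  have hρi : Integrable ρ := hc.integrable_of_hasCompactSupport hs
  refine ⟨hnn, hcR, ?_, ?_⟩
  · obtain ⟨C, hC⟩ := hsR.exists_bound_of_continuous hcR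
    refine ⟨C, (norm_nonneg _).trans (hC 0), fun x => (le_abs_self _).trans (hC x)⟩
  · rw [← ofReal_integral_eq_lintegral_ofReal (hcR.integrable_of_hasCompactSupport hsR) (Eventually.of_forall hnn)]
    rw [e, integral_convolution _ hρi hρi, hi]
    simp

lemma AuxR.moll {R : (Fin 2 → ℝ) → ℝ} (h : AuxR R) {ε : ℝ} (hε : 0 < ε) : AuxR (mollify R ε) := by
  refine ⟨fun x => mul_nonneg (by positivity) (h.nonneg _), ?_, ?_, ?_⟩
  · unfold mollify
    have := h.cont
    fun_prop
  · obtain ⟨M, hM, hR⟩ := h.bdd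
    exact ⟨(ε ^ 2)⁻¹ * M, by positivity, fun x => mul_le_mul_of_nonneg_left (hR _) (by positivity)⟩
  · unfold mollify
    simp only [ENNReal.ofReal_mul (by positivity : 0 ≤ (ε ^ 2)⁻¹)]
    have := h.cont
    have hRi : Integrable R := by
      refine ⟨h.cont.aestronglyMeasurable, ?_⟩
      rw [hasFiniteIntegral_iff_ofReal (Eventually.of_forall h.nonneg)]
      exact h.int.trans_lt ENNReal.one_lt_top
    rw [lintegral_const_mul _ (by fun_prop)]
    rw [← ofReal_integral_eq_lintegral_ofReal (hRi.comp_smul (by positivity)) (Eventually.of_forall fun x => h.nonneg _)]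
    rw [Measure.integral_comp_inv_smul]
    rw [← ENNReal.ofReal_mul (by positivity)]
    have h1 := h.int
    rw [← ofReal_integral_eq_lintegral_ofReal hRi (Eventually.of_forall h.nonneg)] at h1
    refine le_trans (le_of_eq ?_) h1
    congr 1
    simp
    field_simp

lemma AuxR.meas {R : (Fin 2 → ℝ) → ℝ} (h : AuxR R) : Measurable (fun x => ENNReal.ofReal (R x)) := by
  have := h.cont.measurable
  fun_prop

lemma aux_alphaSet {R : (Fin 2 → ℝ) → ℝ} {ε : ℝ} (h : AuxR (mollify R ε)) {Ω : Type*} {X Y : ℝ → Ω → Fin 2 → ℝ}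
    (hX : ∀ ω, Continuous (fun s => X s ω)) (hY : ∀ ω, Continuous (fun s => Y s ω)) (A : Set (ℝ × ℝ)) (ω : Ω) :
    alphaSet R ε X Y A ω = (auxAl (fun x => ENNReal.ofReal (mollify R ε x)) X Y A ω).toReal := by
  unfold alphaSet auxAl
  rw [integral_eq_lintegral_of_nonneg_ae (Eventually.of_forall fun _ => h.nonneg _)]
  apply Continuous.aestronglyMeasurable
  exact h.cont.comp (((hX ω).comp continuous_snd).sub ((hY ω).comp continuous_fst))

lemma aux_heat_nonneg {v : ℝ} (hv : 0 ≤ v) (x : Fin 2 → ℝ) : 0 ≤ heatKernel v x := by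
  unfold heatKernel; positivity

lemma aux_nuReg {R : (Fin 2 → ℝ) → ℝ} {ε : ℝ} (h : AuxR (mollify R ε)) {t : ℝ} (ht : 0 < t) :
    nuReg R ε t = (auxNu (fun x => ENNReal.ofReal (mollify R ε x)) t).toReal := by
  obtain ⟨M, hM0, hM⟩ := h.bdd
  set r := fun x => ENNReal.ofReal (mollify R ε x) with hr
  have hrm : Measurable r := h.meas
  set G : ℝ × ℝ → ENNReal := fun p => ∫⁻ x, r x * ENNReal.ofReal (heatKernel (p.2 - p.1) x) with hG
  have hGm : Measurable G := by
    apply Measurable.lintegral_prod_right'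
      (f := fun q : (ℝ × ℝ) × (Fin 2 → ℝ) => r q.2 * ENNReal.ofReal (heatKernel (q.1.2 - q.1.1) q.2))
    unfold heatKernel
    fun_prop
  have hGb : ∀ p : ℝ × ℝ, p.1 < p.2 → G p ≤ ENNReal.ofReal M := by
    intro p hp
    have e := aux_gauss_lintegral (p.2 - p.1).toNNReal (by simpa using hp) r hrm
    rw [Real.coe_toNNReal _ (by linarith)] at e
    rw [hG]; dsimp only
    rw [← e]
    calc _ ≤ ∫⁻ x, ENNReal.ofReal M ∂(gaussianPi (Fin 2) (p.2 - p.1).toNNReal) :=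
          lintegral_mono (fun x => ENNReal.ofReal_le_ofReal (hM x))
      _ = _ := by simp
  have hGe : ∀ u s : ℝ, u ≤ s → ∫ x : Fin 2 → ℝ, mollify R ε x * heatKernel (s - u) x = (G (u, s)).toReal := by
    intro u s hus
    rw [integral_eq_lintegral_of_nonneg_ae
      (Eventually.of_forall fun x => mul_nonneg (h.nonneg _) (aux_heat_nonneg (by linarith) _))]
    · simp only [ENNReal.ofReal_mul (h.nonneg _)]
      rfl
    · refine Measurable.aestronglyMeasurable (h.cont.measurable.mul ?_)
      unfold heatKernel; fun_prop
  set H : ℝ → ENNReal := fun s => ∫⁻ u, (Ico 0 s).indicator (fun u => G (u, s)) u with hH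
  have hHe : ∀ s, H s = ∫⁻ u in Ioo 0 s, G (u, s) := by
    intro s
    rw [hH]; dsimp only
    rw [lintegral_indicator measurableSet_Ico]
    exact setLIntegral_congr Ioo_ae_eq_Ico.symm
  have hHfin : ∀ s, H s < ⊤ := by
    intro s
    rw [hHe]
    calc _ ≤ ∫⁻ u in Ioo 0 s, ENNReal.ofReal M := setLIntegral_mono' measurableSet_Ioo (fun u hu => hGb _ hu.2)
      _ < ⊤ := by
        rw [setLIntegral_const, Real.volume_Ioo]; exact ENNReal.mul_lt_top ENNReal.ofReal_lt_top ENNReal.ofReal_lt_top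
  have hind : Measurable (fun q : ℝ × ℝ => (Ico 0 q.2).indicator (fun u => G (u, q.2)) q.1) := by
    have : (fun q : ℝ × ℝ => (Ico 0 q.2).indicator (fun u => G (u, q.2)) q.1) =
      ({q : ℝ × ℝ | 0 ≤ q.1} ∩ {q | q.1 < q.2}).indicator G := by
      ext q
      simp only [indicator, mem_Ico, mem_inter_iff, mem_ofPred_eq]
    rw [this]
    exact hGm.indicator ((measurableSet_le measurable_const measurable_fst).inter
      (measurableSet_lt measurable_fst measurable_snd))
  have hHm : Measurable H := Measurable.lintegral_prod_left' hind
  have e1 : auxNu r t = ∫⁻ s in Ioc 0 t, H s := by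
    unfold auxNu
    rw [← lintegral_indicator (aux_ltSet_meas t), Measure.volume_eq_prod, lintegral_prod_symm]
    · rw [← lintegral_indicator measurableSet_Ioc]
      congr 1; ext1 s
      by_cases hs : s ∈ Ioc 0 t
      · rw [indicator_of_mem hs, hH]
        dsimp only
        congr 1; ext1 u
        simp only [indicator, ltSet, mem_ofPred_eq, mem_Ico, hs.2, and_true]
        rfl
      · rw [indicator_of_notMem hs]
        rw [← lintegral_zero]
        congr 1; ext1 u
        apply indicator_of_notMem
        rintro ⟨h1, h2, h3⟩
        exact hs ⟨lt_of_le_of_lt h1 h2, h3⟩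
    · exact (hGm.indicator (aux_ltSet_meas t)).aemeasurable
  rw [e1, ← integral_toReal hHm.aemeasurable (Eventually.of_forall hHfin)]
  unfold nuReg
  rw [intervalIntegral.integral_of_le ht.le]
  refine setIntegral_congr_fun measurableSet_Ioc (fun s hs => ?_)
  rw [intervalIntegral.integral_of_le hs.1.le, integral_Ioc_eq_integral_Ioo, hHe, ← integral_toReal]
  · exact setIntegral_congr_fun measurableSet_Ioo (fun u hu => hGe _ _ hu.2.le)
  · exact (hGm.comp (by fun_prop : Measurable (fun u : ℝ => (u, s)))).aemeasurable
  · refine (ae_restrict_iff' measurableSet_Ioo).2 (Eventually.of_forall fun u hu => ?_)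
    exact (hGb (u, s) hu.2).trans_lt ENNReal.ofReal_lt_top


section
variable {Ω : Type*} [MeasurableSpace Ω] {ι : Type*} [Fintype ι]

lemma IsStdBM.aux_law {P : Measure Ω} {W : ℝ → Ω → ι → ℝ} (h : IsStdBM P W) {s : ℝ} (hs : 0 ≤ s) :
    P.map (W s) = gaussianPi ι s.toNNReal := by
  have := h.gauss_incr 0 s le_rfl hs
  simpa [h.init] using this

lemma IsStdBM.aux_meas {P : Measure Ω} {W : ℝ → Ω → ι → ℝ} (h : IsStdBM P W) (s : ℝ) (i : ι) :
    Measurable (fun ω => W s ω i) := (measurable_pi_apply i).comp (h.meas s)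

lemma IsStdBM.aux_law1 {P : Measure Ω} {W : ℝ → Ω → ι → ℝ} (h : IsStdBM P W) {s : ℝ} (hs : 0 ≤ s) (i : ι) :
    P.map (fun ω => W s ω i) = gaussianReal 0 s.toNNReal := by
  have e : (fun ω => W s ω i) = (Function.eval i) ∘ W s := rfl
  rw [e, ← Measure.map_map (measurable_pi_apply i) (h.meas s), h.aux_law hs]
  unfold gaussianPi
  exact (measurePreserving_eval (fun _ : ι => gaussianReal 0 s.toNNReal) i).map_eq

lemma IsStdBM.aux_indep {P : Measure Ω} {W : ℝ → Ω → ι → ℝ} (h : IsStdBM P W) {s : ℝ} (hs : 0 ≤ s) :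
    iIndepFun (fun i ω => W s ω i) P := by
  have := h.isProb
  rw [iIndepFun_iff_map_fun_eq_pi_map (fun i => (h.aux_meas s i).aemeasurable)]
  simp only [h.aux_law1 hs]
  exact h.aux_law hs

lemma IsStdBM.aux_gl1 {P : Measure Ω} {W : ℝ → Ω → ι → ℝ} (h : IsStdBM P W) {s : ℝ} (hs : 0 ≤ s) (i : ι) :
    HasGaussianLaw (fun ω => W s ω i) P :=
  ⟨by rw [h.aux_law1 hs i]; infer_instance⟩

lemma IsStdBM.aux_gp {P : Measure Ω} {W : ℝ → Ω → ι → ℝ} (h : IsStdBM P W) :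
    IsGaussianProcess (fun (q : ℝ × ι) ω => W (max q.1 0) ω q.2) P := by
  have hgauss : IsGaussianProcess (fun (s : NNReal) ω => W s ω) P := by
    apply HasIndepIncrements.isGaussianProcess
    · intro s
      exact iIndepFun.hasGaussianLaw (fun i => h.aux_gl1 s.2 i) (h.aux_indep s.2)
    · exact Eventually.of_forall fun ω => h.init ω
    · intro n t ht
      exact h.indep_incr n (fun i => (t i : ℝ)) (fun i => (t i).2) (fun i j hij => ht hij)
  refine hgauss.of_isGaussianProcess (fun q => ⟨{q.1.toNNReal},
    { toFun x := x ⟨q.1.toNNReal, by simp⟩ q.2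
      map_add' x y := by simp
      map_smul' m x := by simp }, ?_⟩)
  intro ω
  simp

lemma IsStdBM.aux_cov {P : Measure Ω} {W : ℝ → Ω → ι → ℝ} [DecidableEq ι] (h : IsStdBM P W) {s t : ℝ} (hs : 0 ≤ s)
    (ht : 0 ≤ t) (i j : ι) :
    cov[fun ω => W s ω i, fun ω => W t ω j; P] = if i = j then min s t else 0 := by
  have := h.isProb
  wlog hst : s ≤ t generalizing s t i j
  · have := this ht hs j i (by linarith)
    rw [covariance_comm, this, min_comm]
    simp only [eq_comm]
  have hL : ∀ {s} (hs : 0 ≤ s) i, MemLp (fun ω => W s ω i) 2 P := fun hs i => (h.aux_gl1 hs i).memLp_two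
  have hind : IndepFun (fun ω => W s ω i) (fun ω => W t ω j - W s ω j) P := by
    have h2 := h.indep_incr 2 ![0, s, t] (by intro i; fin_cases i <;> simp [hs, ht])
      (by
        rw [Fin.monotone_iff_le_succ]
        intro i; fin_cases i <;> simp [hs, hst])
    have h3 := h2.indepFun (i := 0) (j := 1) (by decide)
    have h4 := h3.comp (measurable_pi_apply i) (measurable_pi_apply j)
    simpa [h.init, Function.comp_def] using h4
  have e : (fun ω => W t ω j) = (fun ω => W s ω j) + (fun ω => W t ω j - W s ω j) := by
    ext ω; simp
  have hD : MemLp (fun ω => W t ω j - W s ω j) 2 P := (hL ht j).sub (hL hs j)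
  rw [e, covariance_add_right (hL hs i) (hL hs j) hD,
    hind.covariance_eq_zero (hL hs i) hD, add_zero, min_eq_left hst]
  split_ifs with hij
  · subst hij
    rw [covariance_self (h.aux_meas s i).aemeasurable, ← variance_id_map (h.aux_meas s i).aemeasurable,
      h.aux_law1 hs, variance_id_gaussianReal, Real.coe_toNNReal _ hs]
  · exact ((h.aux_indep hs).indepFun hij).covariance_eq_zero (hL hs i) (hL hs j)

def auxW {Ω κ : Type*} (W : ℝ → Ω → κ × Fin 2 → ℝ) (k : κ) : ℝ → Ω → Fin 2 → ℝ :=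
  fun t ω i => W (max t 0) ω (k, i)

lemma IsStdBM.auxGB {P : Measure Ω} {κ : Type*} [Fintype κ] {W : ℝ → Ω → κ × Fin 2 → ℝ} (h : IsStdBM P W)
    (k : κ) (T : ℝ) : AuxGB P T (auxW W k) := by
  classical
  refine ⟨h.isProb, ?_, ?_, ?_, ?_, ?_⟩
  · intro s
    exact measurable_pi_lambda _ (fun i => h.aux_meas _ _)
  · intro ω
    exact continuous_pi (fun i => (h.cont ω (k, i)).comp (by fun_prop))
  · exact h.aux_gp.comp_right (fun q : ℝ × Fin 2 => (q.1, (k, q.2)))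
  · intro s i
    unfold auxW
    have := integral_map (μ := P) (φ := fun ω => W (max s 0) ω (k, i)) (f := fun x : ℝ => x)
      (h.aux_meas _ _).aemeasurable (by fun_prop)
    rw [← this, h.aux_law1 (le_max_right _ _), integral_id_gaussianReal]
  · intro s t hs ht i j
    unfold auxW
    rw [h.aux_cov (le_max_right _ _) (le_max_right _ _), max_eq_left hs.1, max_eq_left ht.1]
    simp

lemma IsStdBM.auxGB_indep {P : Measure Ω} {κ : Type*} [Fintype κ] {W : ℝ → Ω → κ × Fin 2 → ℝ} (h : IsStdBM P W)
    {k l : κ} (hkl : k ≠ l) (T : ℝ) : IndepFun (auxPath (auxW W k) T) (auxPath (auxW W l) T) P := by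
  classical
  have := aux_indep_comb h.aux_gp (fun q : Icc (0:ℝ) T × Fin 2 => ((q.1 : ℝ), (k, q.2)))
    (fun q => ((q.1 : ℝ), (k, q.2))) (fun _ => 0)
    (fun q : Icc (0:ℝ) T × Fin 2 => ((q.1 : ℝ), (l, q.2))) (fun q => ((q.1 : ℝ), (l, q.2))) (fun _ => 0) ?_
  · simp only [zero_mul, sub_zero] at this
    exact this
  · intro s s'
    simp only [zero_mul, sub_zero, add_zero]
    rw [h.aux_cov (le_max_right _ _) (le_max_right _ _), if_neg]
    simp [hkl]

end


lemma aux_jensen {Ω S : Type*} [MeasurableSpace Ω] {P : Measure Ω} (s : Finset S) (z : S → Ω → ℝ)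
    (hz : ∀ i ∈ s, Measurable (z i)) (hs : 0 < s.card) (θ C : ℝ)
    (hb : ∀ i ∈ s, ∫⁻ ω, ENNReal.ofReal (Real.exp (θ * s.card * z i ω)) ∂P ≤ ENNReal.ofReal C) :
    ∫⁻ ω, ENNReal.ofReal (Real.exp (θ * ∑ i ∈ s, z i ω)) ∂P ≤ ENNReal.ofReal C := by
  have hN : (0:ℝ) < s.card := by exact_mod_cast hs
  have h1 : ∀ ω, ENNReal.ofReal (Real.exp (θ * ∑ i ∈ s, z i ω)) ≤
      ∑ i ∈ s, ENNReal.ofReal (1 / s.card) * ENNReal.ofReal (Real.exp (θ * s.card * z i ω)) := by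
    intro ω
    have := convexOn_exp.map_sum_le (t := s) (w := fun _ => 1 / (s.card : ℝ)) (p := fun i => θ * s.card * z i ω)
      (fun i _ => by positivity) (by simp; field_simp) (fun i _ => mem_univ _)
    simp only [← ENNReal.ofReal_mul (by positivity : 0 ≤ 1 / (s.card : ℝ))]
    rw [← ENNReal.ofReal_sum_of_nonneg (fun i _ => by positivity)]
    apply ENNReal.ofReal_le_ofReal
    refine le_trans (le_of_eq ?_) this
    congr 1
    rw [Finset.mul_sum]
    refine Finset.sum_congr rfl (fun i _ => ?_)
    rw [smul_eq_mul]; field_simp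
  calc _ ≤ _ := lintegral_mono h1
    _ = ∑ i ∈ s, ∫⁻ ω, ENNReal.ofReal (1 / s.card) * ENNReal.ofReal (Real.exp (θ * s.card * z i ω)) ∂P := by
      refine lintegral_finsetSum' _ (fun i hi => Measurable.aemeasurable ?_)
      have := hz i hi
      fun_prop
    _ ≤ ∑ i ∈ s, ENNReal.ofReal (1 / s.card) * ENNReal.ofReal C := by
      refine Finset.sum_le_sum (fun i hi => ?_)
      rw [lintegral_const_mul' _ _ ENNReal.ofReal_ne_top]
      gcongr
      exact hb i hi
    _ = _ := by
      rw [Finset.sum_const, nsmul_eq_mul, ← mul_assoc, ← ENNReal.ofReal_natCast,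
        ← ENNReal.ofReal_mul (by positivity)]
      have : (s.card : ℝ) * (1 / s.card) = 1 := by field_simp
      rw [this]; simp

lemma aux_card (n : ℕ) : ((Finset.univ.filter (fun p : Fin n × Fin n => p.1 < p.2)).card : ℝ) = n * (n - 1) / 2 := by
  have h : (Finset.univ.filter (fun p : Fin n × Fin n => p.1 < p.2)).card * 2 = n * (n - 1) := by
    rw [← Finset.sum_range_id_mul_two, ← Fin.sum_univ_eq_sum_range (fun i => i)]
    congr 1
    rw [Finset.card_filter, ← Finset.univ_product_univ, Finset.sum_product_right]
    refine Finset.sum_congr rfl (fun j _ => ?_)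
    rw [← Finset.card_filter]
    have : Finset.univ.filter (fun i : Fin n => i < j) = Finset.Iio j := by ext; simp
    rw [this, Fin.card_Iio]
  have h2 : (((Finset.univ.filter (fun p : Fin n × Fin n => p.1 < p.2)).card * 2 : ℕ) : ℝ) = n * (n - 1) := by
    rw [h]
    rcases n with _ | n
    · simp
    · simp
  push_cast at h2
  linarith

lemma aux_planar {R : (Fin 2 → ℝ) → ℝ} {ε : ℝ} {Ω κ : Type*} (W : ℝ → Ω → κ × Fin 2 → ℝ) (k l : κ)
    {T : ℝ} (A : Set (ℝ × ℝ)) (hA : MeasurableSet A) (hAT : A ⊆ Icc 0 T ×ˢ Icc 0 T) (ω : Ω) :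
    alphaSet R ε (planarComp W k) (planarComp W l) A ω = alphaSet R ε (auxW W k) (auxW W l) A ω := by
  unfold alphaSet
  refine setIntegral_congr_fun hA (fun p hp => ?_)
  have h1 := (hAT hp).1.1
  have h2 := (hAT hp).2.1
  have e1 : planarComp W k p.2 ω = auxW W k p.2 ω := by
    ext i; simp [planarComp, auxW, h2]
  have e2 : planarComp W l p.1 ω = auxW W l p.1 ω := by
    ext i; simp [planarComp, auxW, h1]
  simp only [e1, e2]

/-- There exist universal constants `λ, C > 0` such that for every `n ∈ ℕ` and
`θ > 0`, with `N = n(n+1)/2`, if `0 < t < λ/(θN)` then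
`sup_{ε ∈ (0,1)} E[exp(θ (I_n^ε(t) - n ν_ε(t)))] ≤ C`. -/
theorem stmt_14 :
    ∃ lam C : ℝ, 0 < lam ∧ 0 < C ∧
      ∀ (ρ R : (Fin 2 → ℝ) → ℝ), Continuous ρ → (∀ x, 0 ≤ ρ x) → (∀ x, ρ (-x) = ρ x) →
        HasCompactSupport ρ → (∫ x : Fin 2 → ℝ, ρ x) = 1 →
        (∀ x, R x = ∫ y : Fin 2 → ℝ, ρ (x - y) * ρ y) →
        ∀ (n : ℕ) (θ : ℝ), 0 < θ →
          ∀ t : ℝ, 0 < t → t < lam / (θ * (n * (n + 1) / 2)) →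
            ∀ (Ω : Type*) [MeasurableSpace Ω] (P : Measure Ω)
              (W : ℝ → Ω → (Fin n × Fin 2) → ℝ), IsStdBM P W →
              ∀ ε : ℝ, ε ∈ Set.Ioo (0:ℝ) 1 →
                (∫⁻ ω, ENNReal.ofReal
                    (Real.exp (θ * (Ifun R ε W t ω - n * nuReg R ε t))) ∂P)
                  ≤ ENNReal.ofReal C := by
  refine ⟨2 / (3 * Real.exp 2), Real.exp 1, by positivity, by positivity, ?_⟩
  intro ρ R hc h0 _ hs hi hR n θ hθ t ht htl Ω _ P W hW ε hε
  have hRm : AuxR (mollify R ε) := (aux_R hc h0 hs hi hR).moll hε.1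
  obtain ⟨M, hM0, hM⟩ := hRm.bdd
  have hn : 0 < n := by
    rcases Nat.eq_zero_or_pos n with rfl | h
    · simp at htl; linarith
    · exact h
  have hn' : (0:ℝ) < n := by exact_mod_cast hn
  set r : (Fin 2 → ℝ) → ENNReal := fun x => ENNReal.ofReal (mollify R ε x) with hr
  have hrm : Measurable r := hRm.meas
  have hrM : ∀ x, r x ≤ ENNReal.ofReal M := fun x => ENNReal.ofReal_le_ofReal (hM x)
  set F := Finset.univ.filter (fun p : Fin n × Fin n => p.1 < p.2) with hF
  set S : Finset (Fin n ⊕ (Fin n × Fin n)) := Finset.univ.disjSum F with hS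
  have hcard : (S.card : ℝ) = n * (n + 1) / 2 := by
    rw [hS, Finset.card_disjSum, Nat.cast_add, aux_card]
    simp; ring
  have hgb := fun k => hW.auxGB k t
  set z : Fin n ⊕ (Fin n × Fin n) → Ω → ℝ := Sum.elim
    (fun k ω => (auxAl r (auxW W k) (auxW W k) (ltSet t) ω).toReal - (auxNu r t).toReal)
    (fun p ω => (auxAl r (auxW W p.1) (auxW W p.2) (Icc 0 t ×ˢ Icc 0 t) ω).toReal) with hz
  have hzm : ∀ i, Measurable (z i) := by
    rintro (k | p)
    · exact (auxAl_meas (hgb k).meas (hgb k).cont (hgb k).meas (hgb k).cont r hrm _).ennreal_toReal.sub_const _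
    · exact (auxAl_meas (hgb p.1).meas (hgb p.1).cont (hgb p.2).meas (hgb p.2).cont r hrm _).ennreal_toReal
  have e : ∀ ω, Ifun R ε W t ω - n * nuReg R ε t = ∑ i ∈ S, z i ω := by
    intro ω
    rw [hS, Finset.sum_disjSum, aux_nuReg hRm ht]
    simp only [hz, Sum.elim_inl, Sum.elim_inr, Finset.sum_sub_distrib, Finset.sum_const, Finset.card_univ,
      Fintype.card_fin, nsmul_eq_mul]
    unfold Ifun
    have a1 : ∀ k, betaSet R ε (planarComp W k) (ltSet t) ω = (auxAl r (auxW W k) (auxW W k) (ltSet t) ω).toReal := by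
      intro k
      rw [← aux_alphaSet hRm (hgb k).cont (hgb k).cont,
        ← aux_planar W k k _ (aux_ltSet_meas t) (aux_ltSet_sub t)]
      rfl
    have a2 : ∀ p : Fin n × Fin n, alphaSet R ε (planarComp W p.1) (planarComp W p.2) (Set.Icc 0 t ×ˢ Set.Icc 0 t) ω
        = (auxAl r (auxW W p.1) (auxW W p.2) (Icc 0 t ×ˢ Icc 0 t) ω).toReal := by
      intro p
      rw [← aux_alphaSet hRm (hgb p.1).cont (hgb p.2).cont,
        ← aux_planar W p.1 p.2 _ (measurableSet_Icc.prod measurableSet_Icc) subset_rfl]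
    simp only [a1, a2]
    ring
  simp only [e]
  have hκt : θ * S.card * (Real.exp 2 / 2 * t) ≤ 1 / 3 := by
    rw [hcard]
    rw [lt_div_iff₀ (by positivity)] at htl
    have e2 := Real.exp_pos 2
    calc _ = Real.exp 2 / 2 * (t * (θ * (n * (n + 1) / 2))) := by ring
      _ ≤ Real.exp 2 / 2 * (2 / (3 * Real.exp 2)) := by gcongr
      _ = _ := by field_simp
  refine aux_jensen S z (fun i _ => hzm i) ?_ θ _ ?_
  · have : (0:ℝ) < S.card := by rw [hcard]; positivity
    exact_mod_cast this
  · rintro (k | p) hi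
    · exact AuxGB.beta hrm hRm.int M hM0 hrM ht (by positivity) hκt (hgb k)
    · have hp : p.1 < p.2 := by
        rw [hS, Finset.inr_mem_disjSum, hF, Finset.mem_filter] at hi
        exact hi.2
      exact AuxGB.alpha hrm hRm.int M hM0 hrM ht (by positivity) hκt (hgb p.1) (hgb p.2) (hW.auxGB_indep hp.ne t)
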